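/- Let i ≠ j ∈ Q_0 and let Λ' := Λ/(1−e_i−e_j), regarded as a right Λ-module (it is a basic support τ-tilting Λ-module). Then: (1) Q has no arrow between i and j (in either direction) if and only if Λ' ∈ dip(X_i) ∩ dip(X_j); (2) Q has an arrow from i to j and no arrow from j to i if and only if Λ' ∈ dip(X_j) \ dip(X_i); (3) Q has an arrow from i to j and an arrow from j to i if and only if Λ' ∉ dip(X_i) ∪ dip(X_j). -/

import Mathlib

/-!
Common framework for formalizing statements from
"From support τ-tilting posets to algebras" (R. Kase).

Modules over the basic finite dimensional algebra `Λ` are taken to be *right*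
modules, encoded as (left) modules over the opposite ring `Λᵐᵒᵖ`.
τ-rigidity is encoded through the Auslander–Smalø criterion:
`Hom(M, τM) = 0` iff `Ext¹(M, Fac M) = 0`, and the vanishing of `Ext¹(M, X)`
is encoded by the splitting of all short exact sequences `0 → X → E → M → 0`.
-/

open MulOpposite

namespace TauTilting

/-- Bundled modules over `A` (in `Type 0`). -/
abbrev Mdl (A : Type) [Ring A] := ModuleCat.{0} A

variable {A B : Type} [Ring A] [Ring B]

/-- `X ∈ Fac M` : `X` is a factor of a finite direct sum of copies of `M`. -/
def MemFac (M X : Mdl A) : Prop :=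
  ∃ (n : ℕ) (f : (Fin n → M) →ₗ[A] X), Function.Surjective f

/-- Every short exact sequence `0 → X → E → M → 0` splits, i.e. `Ext¹(M, X) = 0`. -/
def Ext1Vanish (M X : Mdl A) : Prop :=
  ∀ (E : Mdl A) (f : X →ₗ[A] E) (g : E →ₗ[A] M),
    Function.Injective f → Function.Surjective g →
    LinearMap.range f = LinearMap.ker g →
    ∃ s : M →ₗ[A] E, g.comp s = LinearMap.id

/-- `M` is τ-rigid (Auslander–Smalø: `Hom(M, τM) = 0 ↔ Ext¹(M, Fac M) = 0`). -/
def IsTauRigid (M : Mdl A) : Prop :=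
  Module.Finite A M ∧ ∀ X : Mdl A, MemFac M X → Ext1Vanish M X

/-- `M` is indecomposable. -/
def IsIndec (M : Mdl A) : Prop :=
  Nontrivial M ∧ ∀ N N' : Submodule A M, IsCompl N N' → N = ⊥ ∨ N' = ⊥

/-- `F` is an (internal) decomposition of `M` into indecomposable direct summands. -/
def IsDecompOf (M : Mdl A) {n : ℕ} (F : Fin n → Submodule A M) : Prop :=
  iSupIndep F ∧ iSup F = ⊤ ∧ ∀ k, IsIndec (ModuleCat.of A (F k))

/-- `|M| = n` : `M` decomposes into `n` indecomposable direct summands. -/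
def HasNumSummands (M : Mdl A) (n : ℕ) : Prop :=
  ∃ F : Fin n → Submodule A M, IsDecompOf M F

/-- `M` is basic: its indecomposable direct summands are pairwise non-isomorphic. -/
def IsBasicMod (M : Mdl A) : Prop :=
  ∃ (n : ℕ) (F : Fin n → Submodule A M), IsDecompOf M F ∧
    ∀ k l : Fin n, k ≠ l → IsEmpty (↥(F k) ≃ₗ[A] ↥(F l))

def ModIso (M N : Mdl A) : Prop := Nonempty (M ≃ₗ[A] N)

/-- The order on support τ-tilting modules: `M ≤ N ↔ Fac M ⊆ Fac N`. -/
def FacLE (M N : Mdl A) : Prop := ∀ X : Mdl A, MemFac M X → MemFac N X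
def FacLT (M N : Mdl A) : Prop := FacLE M N ∧ ¬ FacLE N M
/-- Equality in the poset of iso-classes: mutual `≤`. -/
def PE (M N : Mdl A) : Prop := FacLE M N ∧ FacLE N M

/-- `N` is a direct summand of `M`. -/
def IsSummand (N M : Mdl A) : Prop :=
  ∃ (f : N →ₗ[A] M) (g : M →ₗ[A] N), g.comp f = LinearMap.id
/-- `N ∈ add M`. -/
def InAdd (N M : Mdl A) : Prop := ∃ n : ℕ, IsSummand N (ModuleCat.of A (Fin n → M))
def HomZero (R M : Mdl A) : Prop := ∀ f : R →ₗ[A] M, f = 0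

/-- Direct sum of two bundled modules. -/
def dsum (M N : Mdl A) : Mdl A := ModuleCat.of A (M × N)

/-- Hasse-quiver arrow `M → N` (so `N` is a direct successor of `M`, and `M` a
direct predecessor of `N`) in the poset of all modules satisfying `P`,
ordered by `FacLE`. -/
def HArrow (P : Mdl A → Prop) (M N : Mdl A) : Prop :=
  P M ∧ P N ∧ FacLT N M ∧ ∀ C, P C → FacLT N C → FacLT C M → False

def IsMaxOf (P : Mdl A → Prop) (T : Mdl A) : Prop := P T ∧ ∀ S, P S → FacLE S T
def IsMinOf (P : Mdl A → Prop) (T : Mdl A) : Prop := P T ∧ ∀ S, P S → FacLE T S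

/-- `T` has exactly `n` direct successors (counted up to poset equality). -/
def SuccsCard (P : Mdl A → Prop) (T : Mdl A) (n : ℕ) : Prop :=
  ∃ g : Fin n → Mdl A, (∀ k, HArrow P T (g k)) ∧
    (∀ k l, k ≠ l → ¬ PE (g k) (g l)) ∧ ∀ S, HArrow P T S → ∃ k, PE S (g k)

/-- `T` has exactly `n` direct predecessors (counted up to poset equality). -/
def PredsCard (P : Mdl A → Prop) (T : Mdl A) (n : ℕ) : Prop :=
  ∃ g : Fin n → Mdl A, (∀ k, HArrow P (g k) T) ∧
    (∀ k l, k ≠ l → ¬ PE (g k) (g l)) ∧ ∀ S, HArrow P S T → ∃ k, PE S (g k)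

/-- The poset of modules satisfying `P` (ordered by `FacLE`) is a lattice. -/
def IsLatticeP (P : Mdl A → Prop) : Prop :=
  ∀ M N, P M → P N →
    (∃ J, P J ∧ FacLE M J ∧ FacLE N J ∧ ∀ C, P C → FacLE M C → FacLE N C → FacLE J C) ∧
    (∃ W, P W ∧ FacLE W M ∧ FacLE W N ∧ ∀ C, P C → FacLE C M → FacLE C N → FacLE C W)

/-- A poset isomorphism between the posets (of isomorphism classes) of modules
satisfying `PA` resp. `PB`, ordered by `FacLE`. -/
structure PosetIsoP (PA : Mdl A → Prop) (PB : Mdl B → Prop) where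
  toFun : Mdl A → Mdl B
  invFun : Mdl B → Mdl A
  maps : ∀ M, PA M → PB (toFun M)
  maps' : ∀ N, PB N → PA (invFun N)
  le_iff : ∀ M N, PA M → PA N → (FacLE M N ↔ FacLE (toFun M) (toFun N))
  le_iff' : ∀ M N, PB M → PB N → (FacLE M N ↔ FacLE (invFun M) (invFun N))
  left_inv : ∀ M, PA M → PE (invFun (toFun M)) M
  right_inv : ∀ N, PB N → PE (toFun (invFun N)) N

/-- A poset isomorphism between the poset of modules satisfying `P` and an
abstract poset `(β, le)`. -/
structure PosetIsoTo (P : Mdl A → Prop) (β : Type) (le : β → β → Prop) where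
  toFun : Mdl A → β
  invFun : β → Mdl A
  maps' : ∀ b, P (invFun b)
  le_iff : ∀ M N, P M → P N → (FacLE M N ↔ le (toFun M) (toFun N))
  left_inv : ∀ M, P M → PE (invFun (toFun M)) M
  right_inv : ∀ b, toFun (invFun b) = b

/-! ### Ring-level notions -/

variable (Λ : Type) [Ring Λ]

/-- The right ideal generated by a subset, as a right module (i.e. `Λᵐᵒᵖ`-module). -/
def rSpan (S : Set Λ) : Submodule Λᵐᵒᵖ Λ := Submodule.span Λᵐᵒᵖ S
/-- The two-sided ideal `(q) = ΛqΛ`, as a right `Λ`-module. -/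
def tIdeal (q : Λ) : Submodule Λᵐᵒᵖ Λ := Submodule.span Λᵐᵒᵖ {y : Λ | ∃ a : Λ, y = a * q}
/-- The right `Λ`-module `Λ/S`. -/
def quotMod (S : Submodule Λᵐᵒᵖ Λ) : Mdl Λᵐᵒᵖ := ModuleCat.of Λᵐᵒᵖ (Λ ⧸ S)
/-- `Λ` as a right module over itself. -/
def regMod : Mdl Λᵐᵒᵖ := ModuleCat.of Λᵐᵒᵖ Λ
/-- The projective right module `xΛ ≅ Λ/(1-x)Λ` attached to an idempotent `x`. -/
def projMod (x : Λ) : Mdl Λᵐᵒᵖ := quotMod Λ (rSpan Λ {1 - x})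
/-- The right `Λ`-module `Λ/(1-x)`; for `x = e i` this is the module `X_i`. -/
def cyclicQuot (x : Λ) : Mdl Λᵐᵒᵖ := quotMod Λ (tIdeal Λ (1 - x))

/-- `x` is a primitive idempotent. -/
def IsPrimIdem (x : Λ) : Prop :=
  IsIdempotentElem x ∧ x ≠ 0 ∧
    ∀ a b : Λ, IsIdempotentElem a → IsIdempotentElem b →
      a * b = 0 → b * a = 0 → a + b = x → a = 0 ∨ b = 0

variable {ι : Type} [Fintype ι]

/-- `e` is a complete family of orthogonal primitive idempotents of `Λ`. -/
def CompletePrimIdems (e : ι → Λ) : Prop :=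
  (∀ i, IsPrimIdem Λ (e i)) ∧ (Pairwise fun i j => e i * e j = 0) ∧ ∑ i, e i = 1

/-- `Λ` is basic w.r.t. `e`: the `e i Λ` are pairwise non-isomorphic. -/
def IsBasicAlg (e : ι → Λ) : Prop :=
  ∀ i j : ι, i ≠ j → IsEmpty (↥(projMod Λ (e i)) ≃ₗ[Λᵐᵒᵖ] ↥(projMod Λ (e j)))

/-- The support `supp(M) = {i | M·eᵢ ≠ 0}` of a right module `M`. -/
def Supp (e : ι → Λ) (M : Mdl Λᵐᵒᵖ) : Set ι := {i | ∃ m : M, op (e i) • m ≠ 0}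

/-- Support τ-tilting module: τ-rigid with `|M| = #supp(M)`. -/
def IsSTT (e : ι → Λ) (M : Mdl Λᵐᵒᵖ) : Prop :=
  Module.Finite Λᵐᵒᵖ M ∧ IsTauRigid M ∧ HasNumSummands M (Supp Λ e M).ncard

/-- Basic support τ-tilting module. -/
def IsBSTT (e : ι → Λ) (M : Mdl Λᵐᵒᵖ) : Prop := IsSTT Λ e M ∧ IsBasicMod M

/-- τ-tilting module: τ-rigid with `|M| = #Q₀`. -/
def IsTauTiltingMod (e : ι → Λ) (M : Mdl Λᵐᵒᵖ) : Prop :=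
  IsSTT Λ e M ∧ HasNumSummands M (Fintype.card ι)

open scoped Classical in
/-- The idempotent `1 - e_M = Σ_{i ∉ supp M} e i`. -/
noncomputable def cIdem (e : ι → Λ) (M : Mdl Λᵐᵒᵖ) : Λ :=
  ∑ i : ι, if i ∈ Supp Λ e M then 0 else e i

/-- τ-rigid pair `(M, P)`. -/
def IsTauRigidPair (e : ι → Λ) (M P : Mdl Λᵐᵒᵖ) : Prop :=
  IsTauRigid M ∧ Module.Finite Λᵐᵒᵖ P ∧ Module.Projective Λᵐᵒᵖ P ∧
    InAdd P (projMod Λ (cIdem Λ e M))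

/-- Basic τ-rigid pair. -/
def IsBasicTRP (e : ι → Λ) (M P : Mdl Λᵐᵒᵖ) : Prop :=
  IsTauRigidPair Λ e M P ∧ IsBasicMod M ∧ IsBasicMod P

/-- `T ∈ sτtilt_{(N,R)} Λ`, i.e. `N ∈ add T` and `Hom(R, T) = 0`. -/
def InPairSet (N R T : Mdl Λᵐᵒᵖ) : Prop := InAdd N T ∧ HomZero R T

/-- `Λ` is τ-tilting finite: finitely many basic support τ-tilting modules up to iso. -/
def TauTiltingFinite (e : ι → Λ) : Prop :=
  ∃ (n : ℕ) (T : Fin n → Mdl Λᵐᵒᵖ), ∀ M, IsBSTT Λ e M → ∃ k, ModIso M (T k)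

/-- The Jacobson radical of `Λ`, as a `K`-subspace. -/
noncomputable def radK (K : Type) [CommRing K] (Λ : Type) [Ring Λ] [Algebra K Λ] :
    Submodule K Λ :=
  Submodule.restrictScalars K (sInf {I : Ideal Λ | I.IsMaximal})

/-- Powers of the radical, with `rad⁰ = Λ`. -/
noncomputable def radPow (K : Type) [CommRing K] (Λ : Type) [Ring Λ] [Algebra K Λ] :
    ℕ → Submodule K Λ
  | 0 => ⊤
  | n + 1 => radK K Λ ^ (n + 1)

/-! ### Quivers, paths and presentations -/

/-- Paths in a quiver with vertex set `ι` and arrow types `Arr i j`. -/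
inductive QPath {ι : Type} (Arr : ι → ι → Type) : ι → ι → Type
  | nil (i : ι) : QPath Arr i i
  | cons {i j k : ι} (a : Arr i j) (p : QPath Arr j k) : QPath Arr i k

namespace QPath

variable {ι : Type} {Arr : ι → ι → Type}

/-- The list of visited vertices. -/
def verts : ∀ {i j : ι}, QPath Arr i j → List ι
  | i, _, .nil _ => [i]
  | i, _, .cons _ p => i :: p.verts

/-- Evaluation of a path in the algebra `Λ` (trivial path at `i` ↦ `e i`). -/
def eval {Λ : Type} [Ring Λ] (e : ι → Λ) (arr : ∀ i j, Arr i j → Λ) :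
    ∀ {i j : ι}, QPath Arr i j → Λ
  | _, _, .nil i => e i
  | _, _, .cons a p => arr _ _ a * p.eval e arr

def append : ∀ {i j k : ι}, QPath Arr i j → QPath Arr j k → QPath Arr i k
  | _, _, _, .nil _, q => q
  | _, _, _, .cons a p, q => .cons a (p.append q)

def single {i j : ι} (a : Arr i j) : QPath Arr i j := .cons a (.nil j)

end QPath

/-- The condition `xΛe_j = e_iΛe_j = e_iΛx ≠ 0` on an element `x` of `e_iΛe_j`. -/
def Gcond (ei ej x : Λ) : Prop :=
  (Set.range fun b => x * b * ej) = (Set.range fun b => ei * b * ej) ∧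
  (Set.range fun b => ei * b * x) = (Set.range fun b => ei * b * ej) ∧
  ∃ b, ei * b * ej ≠ 0

/-- `w ∈ G(Q, I)` : `w` contains no cycle as a subpath (equivalently, visits no
vertex twice) and `wΛe_j = e_iΛe_j = e_iΛw ≠ 0`. -/
def GMem (e : ι → Λ) {Arr : ι → ι → Type} (arr : ∀ i j, Arr i j → Λ) {i j : ι}
    (w : QPath Arr i j) : Prop :=
  w.verts.Nodup ∧ Gcond Λ (e i) (e j) (w.eval e arr)

/-- Condition 1 for a bound quiver: if `e_iΛe_j ≠ 0` then `G^i_j ≠ ∅`. -/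
def Cond1 (e : ι → Λ) {Arr : ι → ι → Type} (arr : ∀ i j, Arr i j → Λ) : Prop :=
  ∀ i j : ι, (∃ x, e i * x * e j ≠ 0) → ∃ w : QPath Arr i j, GMem Λ e arr w

/-- Ring-level version of Condition 1 (Lemma `eqcd` (iii)). -/
def Cond1R : Prop :=
  ∀ x y : Λ, IsPrimIdem Λ x → IsPrimIdem Λ y → x * y = 0 → y * x = 0 →
    ∃ w : Λ, (∃ b, w = x * b * y) ∧
      (Set.range fun b => w * b * y) = (Set.range fun b => x * b * y) ∧
      (Set.range fun b => x * b * w) = (Set.range fun b => x * b * y)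

/-- `(e, Arr, arr)` presents `Λ` as the bound quiver algebra `KQ/I` with `Q` its
Gabriel quiver: `e` is a complete family of orthogonal primitive idempotents,
`Λ` is basic, each arrow `a : i → j` is sent to an element of `e_i (rad Λ) e_j`,
and the arrows form a `K`-basis of `rad Λ / rad² Λ`. -/
def IsGabrielPres (K : Type) [Field K] [Algebra K Λ] [DecidableEq ι] (e : ι → Λ)
    (Arr : ι → ι → Type) [∀ i j, Fintype (Arr i j)] (arr : ∀ i j, Arr i j → Λ) : Prop :=
  CompletePrimIdems Λ e ∧ IsBasicAlg Λ e ∧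
  (∀ i j (a : Arr i j), arr i j a ∈ radK K Λ ∧ e i * arr i j a * e j = arr i j a) ∧
  (radK K Λ ≤
    Submodule.span K (Set.range fun p : Σ i : ι, Σ j : ι, Arr i j => arr p.1 p.2.1 p.2.2) ⊔
      radK K Λ * radK K Λ) ∧
  (∀ c : (Σ i : ι, Σ j : ι, Arr i j) → K,
    (∑ p : Σ i : ι, Σ j : ι, Arr i j, c p • arr p.1 p.2.1 p.2.2) ∈ radK K Λ * radK K Λ →
    ∀ p, c p = 0)

/-! ### Partitions of a quiver, Condition 2 -/

/-- `x` and `y` are adjacent within the vertex subset `S` (undirected). -/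
def AdjIn {ι : Type} (Arr : ι → ι → Type) (S : Set ι) (x y : ι) : Prop :=
  x ∈ S ∧ y ∈ S ∧ (Nonempty (Arr x y) ∨ Nonempty (Arr y x))

/-- The full subquiver on `S` is connected. -/
def ConnectedOn {ι : Type} (Arr : ι → ι → Type) (S : Set ι) : Prop :=
  ∀ x ∈ S, ∀ y ∈ S, Relation.ReflTransGen (AdjIn Arr S) x y

/-- Adjacency of parts in the quotient quiver `Q^μ`. -/
def PartAdj {ι : Type} (Arr : ι → ι → Type) {ℓ : ℕ} (μ : ι → Fin ℓ) (u v : Fin ℓ) : Prop :=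
  u ≠ v ∧ ∃ x y, μ x = u ∧ μ y = v ∧ (Nonempty (Arr x y) ∨ Nonempty (Arr y x))

/-- Condition 2: there is a partition `μ` of `Q₀` into connected full subquivers
such that `Q^μ` is a tree (connected with `#arrows = #parts - 1`) and each
`sτtilt Λ^{a,b}_μ` — identified with the subposet of `sτtilt Λ` of modules
supported on the union of the two parts — is a lattice. -/
def Cond2 (e : ι → Λ) (Arr : ι → ι → Type) [∀ i j, Fintype (Arr i j)] : Prop :=
  ∃ (ℓ : ℕ) (μ : ι → Fin ℓ), Function.Surjective μ ∧
    (∀ a : Fin ℓ, ConnectedOn Arr {i | μ i = a}) ∧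
    (∀ u v : Fin ℓ, Relation.ReflTransGen (PartAdj Arr μ) u v) ∧
    Nat.card {p : Σ i : ι, Σ j : ι, Arr i j // μ p.1 ≠ μ p.2.1} = ℓ - 1 ∧
    ∀ a b : Fin ℓ, a ≠ b →
      IsLatticeP (fun T : Mdl Λᵐᵒᵖ => IsBSTT Λ e T ∧ Supp Λ e T ⊆ {i | μ i = a ∨ μ i = b})

/-! ### Correspondence of paths under a quiver isomorphism, and `∼` -/

/-- Transport of paths along a quiver isomorphism `σ : Q° → (Q')°` (defined on
non-loop arrows). -/
inductive PathCorr {ι ι' : Type} {Arr : ι → ι → Type} {Arr' : ι' → ι' → Type}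
    (σ : ι → ι') (σ1 : ∀ i j, i ≠ j → Arr i j → Arr' (σ i) (σ j)) :
    ∀ {i j : ι}, QPath Arr i j → QPath Arr' (σ i) (σ j) → Prop
  | nil (i : ι) : PathCorr σ σ1 (QPath.nil i) (QPath.nil (σ i))
  | cons {i j k : ι} (h : i ≠ j) (a : Arr i j) {p : QPath Arr j k}
      {p' : QPath Arr' (σ j) (σ k)} :
      PathCorr σ σ1 p p' → PathCorr σ σ1 (QPath.cons a p) (QPath.cons (σ1 i j h a) p')

/-- The relation `(Q, I) ∼ (Q', I')`: there is a quiver isomorphism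
`σ : Q° → (Q')°` with (a) `supp(e_{σ(i)}Γ) = σ(supp(e_iΛ))` and (b) `G(Γ) = σ(G(Λ))`. -/
def SimCond {Λ Γ : Type} [Ring Λ] [Ring Γ] {ι ι' : Type}
    (e : ι → Λ) {Arr : ι → ι → Type} (arr : ∀ i j, Arr i j → Λ)
    (f : ι' → Γ) {Arr' : ι' → ι' → Type} (arr' : ∀ i j, Arr' i j → Γ) : Prop :=
  ∃ (σ : ι ≃ ι') (σ1 : ∀ i j, i ≠ j → (Arr i j ≃ Arr' (σ i) (σ j))),
    (∀ i j : ι, (∃ x, e i * x * e j ≠ 0) ↔ ∃ y, f (σ i) * y * f (σ j) ≠ 0) ∧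
    (∀ (i j : ι) (w : QPath Arr i j), GMem Λ e arr w →
      ∃ w' : QPath Arr' (σ i) (σ j),
        PathCorr σ (fun i j h => σ1 i j h) w w' ∧ GMem Γ f arr' w') ∧
    (∀ (i j : ι) (w' : QPath Arr' (σ i) (σ j)), GMem Γ f arr' w' →
      ∃ w : QPath Arr i j,
        PathCorr σ (fun i j h => σ1 i j h) w w' ∧ GMem Λ e arr w)

end TauTilting

namespace TauTilting

section Idempotents

variable {A : Type} [Ring A]

/-- A complete family of pairwise non-equivalent orthogonal primitive idempotents. -/
structure IsBasicFamily {ι : Type} [Fintype ι] (e : ι → A) : Prop where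
  prim : ∀ k, IsPrimIdem A (e k)
  orth : ∀ {k l}, k ≠ l → e k * e l = 0
  sum : ∑ k, e k = 1
  notEquiv : ∀ {k l}, k ≠ l → ∀ a b, e k * a * e l * b * e k ≠ e k

theorem exists_pow_eq_pow_succ_mul (K : Type) [Field K] [Algebra K A] [FiniteDimensional K A]
    (x : A) : ∃ (n : ℕ) (h : Polynomial K), x ^ n = x ^ (n + 1) * Polynomial.aeval x h := by
  have hx : IsIntegral K x := Algebra.IsIntegral.isIntegral x
  obtain ⟨q, hq, hdvd⟩ :=
    Polynomial.exists_eq_pow_rootMultiplicity_mul_and_not_dvd _ (minpoly.ne_zero hx) 0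
  rw [Polynomial.C_0, sub_zero] at hq hdvd
  set n := Polynomial.rootMultiplicity 0 (minpoly K x)
  have hq0 : q.coeff 0 ≠ 0 := fun h => hdvd (Polynomial.X_dvd_iff.2 h)
  have key : x ^ n * Polynomial.aeval x q = 0 := by
    have := minpoly.aeval K x
    rw [hq] at this
    simpa using this
  have hsplit : Polynomial.aeval x q
      = x * Polynomial.aeval x q.divX + algebraMap K A (q.coeff 0) := by
    conv_lhs => rw [← Polynomial.X_mul_divX_add q, map_add, map_mul, Polynomial.aeval_X,
      Polynomial.aeval_C]
  refine ⟨n, -(Polynomial.C (q.coeff 0)⁻¹ * q.divX), ?_⟩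
  have hc : algebraMap K A (q.coeff 0) * algebraMap K A (q.coeff 0)⁻¹ = 1 := by
    rw [← map_mul, mul_inv_cancel₀ hq0, map_one]
  rw [hsplit, mul_add] at key
  have h1 : x ^ n * algebraMap K A (q.coeff 0) = -(x ^ n * (x * Polynomial.aeval x q.divX)) :=
    eq_neg_of_add_eq_zero_right key
  calc x ^ n = x ^ n * algebraMap K A (q.coeff 0) * algebraMap K A (q.coeff 0)⁻¹ := by
        rw [mul_assoc, hc, mul_one]
    _ = _ := by
        rw [h1, neg_mul, mul_assoc, mul_assoc,
          ← Algebra.commutes (q.coeff 0)⁻¹ (Polynomial.aeval x q.divX)]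
        simp [pow_succ, mul_assoc]

/-- Fitting's lemma in the corner ring of a primitive idempotent. -/
theorem IsPrimIdem.nilpotent_or_unit (K : Type) [Field K] [Algebra K A] [FiniteDimensional K A]
    {e x : A} (he : IsPrimIdem A e) (hx : e * x * e = x) :
    IsNilpotent x ∨ ∃ y, y * x = e ∧ x * y = e := by
  obtain ⟨n, h, hn⟩ := exists_pow_eq_pow_succ_mul K x
  obtain ⟨hid, -, hprim⟩ := he
  have hid' : e * e = e := hid
  have hex : e * x = x := by rw [← hx]; simp only [← mul_assoc, hid']
  have hxe : x * e = x := by rw [← hx]; simp only [mul_assoc, hid']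
  set z := Polynomial.aeval x h
  have hxz : Commute x z := by
    have := (Polynomial.commute_X h).symm.map (Polynomial.aeval x)
    rw [Polynomial.aeval_X] at this
    exact this.symm
  set w := x * z with hw
  have hxw : Commute x w := (Commute.refl x).mul_right hxz
  have hnw : x ^ n * w = x ^ n := by rw [hw, ← mul_assoc, ← pow_succ, ← hn]
  have hnw' : x ^ (n + 1) * w = x ^ (n + 1) := by rw [pow_succ', mul_assoc, hnw]
  have hpow : ∀ m, x ^ (n + 1) * w ^ m = x ^ (n + 1) := by
    intro m
    induction m with
    | zero => simp
    | succ m ih => rw [pow_succ w, ← mul_assoc, ih, hnw']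
  have hgw : ∀ m, w ^ (n + 1) * w ^ m = w ^ (n + 1) := by
    intro m
    have hz : w ^ (n + 1) = z ^ (n + 1) * x ^ (n + 1) := by
      rw [hw, hxz.eq, hxz.symm.mul_pow]
    rw [hz, mul_assoc, hpow]
  have heg : e * w ^ (n + 1) = w ^ (n + 1) := by
    rw [pow_succ', hw, ← mul_assoc, ← mul_assoc, hex]
  have hge : w ^ (n + 1) * e = w ^ (n + 1) := by
    rw [pow_succ, hw, hxz.eq, mul_assoc, mul_assoc, hxe]
  have hgg : w ^ (n + 1) * w ^ (n + 1) = w ^ (n + 1) := hgw _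
  have hcase := hprim (w ^ (n + 1)) (e - w ^ (n + 1)) hgg
    (by simp [IsIdempotentElem, mul_sub, sub_mul, hid', heg, hge, hgg])
    (by simp [mul_sub, hge, hgg]) (by simp [sub_mul, heg, hgg]) (by abel)
  rcases hcase with h0 | h0
  · exact Or.inl ⟨n + 1, by rw [← hpow (n + 1), h0, mul_zero]⟩
  · have hxw' : Commute x (w ^ n) := hxw.pow_right n
    refine Or.inr ⟨w ^ n * z, ?_, ?_⟩
    · rw [sub_eq_zero.1 h0, mul_assoc, ← hxz.eq, pow_succ]
    · rw [sub_eq_zero.1 h0, ← mul_assoc, hxw'.eq, mul_assoc, pow_succ]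

namespace IsBasicFamily

variable {ι : Type} [Fintype ι] {e : ι → A}

theorem idem (he : IsBasicFamily e) (k : ι) : e k * e k = e k := (he.prim k).1

theorem op (he : IsBasicFamily e) : IsBasicFamily (fun k => MulOpposite.op (e k)) where
  prim k := by
    obtain ⟨h1, h2, h3⟩ := he.prim k
    refine ⟨congrArg MulOpposite.op h1, fun h => h2 (MulOpposite.op_injective h), ?_⟩
    intro a b ha hb hab hba hsum
    have := h3 a.unop b.unop (congrArg MulOpposite.unop ha) (congrArg MulOpposite.unop hb)
      (congrArg MulOpposite.unop hba) (congrArg MulOpposite.unop hab)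
      (congrArg MulOpposite.unop hsum)
    exact this.imp (fun h => MulOpposite.unop_injective h) (fun h => MulOpposite.unop_injective h)
  orth h := congrArg MulOpposite.op (he.orth h.symm)
  sum := by
    rw [← MulOpposite.op_one, ← he.sum]
    exact (map_sum (MulOpposite.opAddEquiv : A ≃+ Aᵐᵒᵖ) e Finset.univ).symm
  notEquiv h a b hab := by
    apply he.notEquiv h b.unop a.unop
    have := congrArg MulOpposite.unop hab
    simpa [mul_assoc] using this

theorem mem_jacobson (he : IsBasicFamily e) (K : Type) [Field K] [Algebra K A]
    [FiniteDimensional K A] {l : ι} {x : A} (hl : x * e l = x) (h : ∀ y, y * x ≠ e l) :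
    x ∈ Ring.jacobson A := by
  rw [Ring.jacobson_eq_sInf_isMaximal, Submodule.mem_sInf]
  intro M hM
  by_contra hxM
  obtain ⟨μ, hμ, y, hy, hsum⟩ := Submodule.mem_sup.1
    ((Ideal.eq_top_iff_one _).1 (hM.1.2 (M ⊔ Ideal.span {x}) (by simpa using hxM)))
  obtain ⟨b, rfl⟩ := Ideal.mem_span_singleton'.1 hy
  set w := e l * b * x with hwdef
  have hw1 : e l * w = w := by simp only [hwdef, ← mul_assoc, he.idem]
  have hw2 : w * e l = w := by simp only [hwdef, mul_assoc, hl]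
  have hmem : e l - w ∈ M := by
    have : e l - w = e l * μ := by
      rw [eq_sub_of_add_eq hsum, mul_sub, mul_one, hwdef, mul_assoc]
    exact this ▸ M.smul_mem (e l) hμ
  rcases (he.prim l).nilpotent_or_unit K (x := w) (by rw [hw1, hw2]) with ⟨n, hn⟩ | ⟨y, hy, -⟩
  · have hpow : ∀ m, e l - w ^ (m + 1) ∈ M := by
      intro m
      induction m with
      | zero => simpa using hmem
      | succ m ih =>
        have := M.add_mem hmem (M.smul_mem w ih)
        simp only [smul_eq_mul, mul_sub, hw2, ← pow_succ'] at this
        simpa using this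
    have hel : e l ∈ M := by
      have := hpow n
      rwa [pow_succ, hn, zero_mul, sub_zero] at this
    exact hxM (hl ▸ M.smul_mem x hel)
  · exact h (y * (e l * b)) (by rw [mul_assoc, hy])

theorem mul_mem_jacobson (he : IsBasicFamily e) (K : Type) [Field K] [Algebra K A]
    [FiniteDimensional K A] {k l : ι} (hkl : k ≠ l) {x : A} (hk : e k * x = x)
    (hl : x * e l = x) : x ∈ Ring.jacobson A := by
  refine he.mem_jacobson K hl fun y hy => he.notEquiv hkl.symm y x ?_
  rw [mul_assoc (e l * y), hk, mul_assoc, hl, mul_assoc, hy, he.idem]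

end IsBasicFamily

end Idempotents

section Fac

variable {A : Type} [Ring A]

theorem memFac_of_linearMap {κ : Type} [Finite κ] {M X : Mdl A} (f : (κ → M) →ₗ[A] X)
    (hf : Function.Surjective f) : MemFac M X := by
  obtain ⟨n, ⟨σ⟩⟩ := Finite.exists_equiv_fin κ
  refine ⟨n, f.comp (LinearMap.funLeft A M σ), hf.comp ?_⟩
  exact LinearMap.funLeft_surjective_of_injective A M σ σ.injective

theorem memFac_of_family {κ : Type} [Fintype κ] {M X : Mdl A} (f : κ → M →ₗ[A] X)
    (hf : ∀ x, ∃ m : κ → M, ∑ t, f t (m t) = x) : MemFac M X := by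
  refine memFac_of_linearMap (∑ t, (f t).comp (LinearMap.proj t)) fun x => ?_
  obtain ⟨m, hm⟩ := hf x
  exact ⟨m, by simpa using hm⟩

theorem memFac_of_surjective {M X : Mdl A} (f : M →ₗ[A] X) (hf : Function.Surjective f) :
    MemFac M X :=
  memFac_of_family (κ := Unit) (fun _ => f) fun x => by
    obtain ⟨m, rfl⟩ := hf x
    exact ⟨fun _ => m, by simp⟩

theorem MemFac.refl (M : Mdl A) : MemFac M M :=
  memFac_of_surjective LinearMap.id Function.surjective_id

theorem MemFac.trans {M N X : Mdl A} (h : MemFac M N) (h' : MemFac N X) : MemFac M X := by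
  obtain ⟨n, f, hf⟩ := h
  obtain ⟨m, g, hg⟩ := h'
  refine memFac_of_family (κ := Fin m × Fin n)
    (fun t => g.comp ((LinearMap.single A (fun _ => N) t.1).comp
      (f.comp (LinearMap.single A (fun _ => M) t.2)))) fun x => ?_
  obtain ⟨y, rfl⟩ := hg x
  choose z hz using fun t => hf (y t)
  refine ⟨fun t => z t.1 t.2, ?_⟩
  rw [Fintype.sum_prod_type]
  simp only [LinearMap.comp_apply, ← map_sum]
  congr 1
  have : ∀ t, ∑ s, f ((LinearMap.single A (fun _ => M) s) (z t s)) = y t := fun t => by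
    rw [← map_sum, ← hz t]
    congr 1
    exact Finset.univ_sum_single (z t)
  calc _ = ∑ t, LinearMap.single A (fun _ => N) t (y t) := by
        refine Finset.sum_congr rfl fun t _ => ?_
        rw [← this t, map_sum, map_sum]
    _ = y := Finset.univ_sum_single y

theorem facLE_iff {M N : Mdl A} : FacLE M N ↔ MemFac N M :=
  ⟨fun h => h M (MemFac.refl M), fun h _ hX => h.trans hX⟩

theorem MemFac.kill {M X : Mdl A} (h : MemFac M X) {q : A} (hq : ∀ m : M, q • m = 0) (x : X) :
    q • x = 0 := by
  obtain ⟨n, f, hf⟩ := h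
  obtain ⟨m, rfl⟩ := hf x
  rw [← map_smul, (funext fun t => hq (m t) : q • m = 0), map_zero]

theorem MemFac.finite {M X : Mdl A} (h : MemFac M X) [Module.Finite A M] : Module.Finite A X := by
  obtain ⟨n, f, hf⟩ := h
  exact Module.Finite.of_surjective f hf

/-- An extension of two modules annihilated by an idempotent is annihilated by it. -/
theorem kill_of_extension {q : A} (hq : q * q = q) {Y E M : Mdl A} (f : Y →ₗ[A] E) (g : E →ₗ[A] M)
    (hfg : LinearMap.range f = LinearMap.ker g) (hY : ∀ y : Y, q • y = 0)
    (hM : ∀ m : M, q • m = 0) (x : E) : q • x = 0 := by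
  have : q • x ∈ LinearMap.range f := by
    rw [hfg, LinearMap.mem_ker, map_smul, hM]
  obtain ⟨y, hy⟩ := this
  rw [← hq, mul_smul, ← hy, ← map_smul, hY, map_zero]

theorem Ext1Vanish.exists_lift {C E : Mdl A} (U : Submodule A E)
    (h : Ext1Vanish C (ModuleCat.of A U)) (p : C →ₗ[A] E ⧸ U) :
    ∃ s : C →ₗ[A] E, U.mkQ.comp s = p := by
  let W : Submodule A (C × E) :=
    LinearMap.ker (p.comp (LinearMap.fst A C E) - U.mkQ.comp (LinearMap.snd A C E))
  have hW : ∀ w : C × E, w ∈ W ↔ p w.1 = U.mkQ w.2 := fun w => by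
    simp [W, LinearMap.mem_ker, sub_eq_zero]
  let f : U →ₗ[A] W := LinearMap.codRestrict W ((LinearMap.inr A C E).comp U.subtype) fun x => by
    rw [hW]
    simpa using ((Submodule.Quotient.mk_eq_zero U).2 x.2).symm
  obtain ⟨s, hs⟩ := h (ModuleCat.of A W) f ((LinearMap.fst A C E).comp W.subtype)
    (fun x y hxy => by
      have := congrArg (fun w : W => w.1.2) hxy
      exact Subtype.ext this)
    (fun c => by
      obtain ⟨x, hx⟩ := U.mkQ_surjective (p c)
      exact ⟨⟨(c, x), (hW _).2 hx.symm⟩, rfl⟩)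
    (by
      ext w
      constructor
      · rintro ⟨x, rfl⟩
        rfl
      · intro hw
        have h1 : w.1.1 = 0 := hw
        have h2 := (hW w.1).1 w.2
        rw [h1, map_zero, eq_comm, Submodule.mkQ_apply, Submodule.Quotient.mk_eq_zero] at h2
        exact ⟨⟨_, h2⟩, Subtype.ext (Prod.ext h1.symm rfl)⟩)
  refine ⟨(LinearMap.snd A C E).comp (W.subtype.comp s), LinearMap.ext fun c => ?_⟩
  have h1 := (hW (s c).1).1 (s c).2
  have h2 : (s c).1.1 = c := congrArg (fun φ => φ c) hs
  rw [h2] at h1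
  exact h1.symm

/-- The factor modules of a τ-rigid module are closed under extensions. -/
theorem IsTauRigid.memFac_of_extension {C E : Mdl A} (hC : IsTauRigid C) (U : Submodule A E)
    (hU : MemFac C (ModuleCat.of A U)) (hQ : MemFac C (ModuleCat.of A (E ⧸ U))) :
    MemFac C E := by
  have hext := hC.2 _ hU
  obtain ⟨m, f, hf⟩ := hU
  obtain ⟨n, g, hg⟩ := hQ
  choose s hs using fun t : Fin n =>
    hext.exists_lift U (g.comp (LinearMap.single A (fun _ => C) t))
  refine memFac_of_family (κ := Fin n ⊕ Fin m) (Sum.elim s fun t =>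
    U.subtype.comp (f.comp (LinearMap.single A (fun _ => C) t))) fun x => ?_
  obtain ⟨y, hy⟩ := hg (U.mkQ x)
  have h1 : U.mkQ (∑ t, s t (y t)) = U.mkQ x := by
    rw [← hy, map_sum]
    calc _ = ∑ t, g (LinearMap.single A (fun _ => C) t (y t)) :=
          Finset.sum_congr rfl fun t _ => congrArg (fun φ => φ (y t)) (hs t)
      _ = g y := by
          rw [← map_sum]; exact congrArg g (Finset.univ_sum_single y)
  have h2 : x - ∑ t, s t (y t) ∈ U := by
    rw [← Submodule.Quotient.mk_eq_zero U, ← Submodule.mkQ_apply, map_sub, h1, sub_self]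
  obtain ⟨z, hz⟩ := hf ⟨_, h2⟩
  refine ⟨Sum.elim y z, ?_⟩
  have h3 : ∑ t, (f (LinearMap.single A (fun _ => C) t (z t)) : E) = x - ∑ t, s t (y t) := by
    have : f z = ∑ t, f (LinearMap.single A (fun _ => C) t (z t)) := by
      rw [← map_sum]; exact congrArg f (Finset.univ_sum_single z).symm
    have h4 := congrArg Subtype.val (this.symm.trans hz)
    exact (map_sum U.subtype _ _).symm.trans h4
  rw [Fintype.sum_sum_type]
  simp only [Sum.elim_inl, Sum.elim_inr, LinearMap.comp_apply, Submodule.subtype_apply]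
  rw [h3]
  abel

end Fac

section Universal

variable {A : Type} [Ring A]

theorem exists_hom_of_cyclic {X M : Mdl A} {u : X} (hgen : ∀ x : X, ∃ a : A, a • u = x) {m : M}
    (hm : ∀ a : A, a • u = 0 → a • m = 0) : ∃ f : X →ₗ[A] M, f u = m := by
  let t := LinearMap.toSpanSingleton A X u
  have ht : Function.Surjective t := fun x => hgen x
  let g := (LinearMap.ker t).liftQ (LinearMap.toSpanSingleton A M m) fun a ha => hm a ha
  refine ⟨g.comp (t.quotKerEquivOfSurjective ht).symm.toLinearMap, ?_⟩
  have : (t.quotKerEquivOfSurjective ht).symm u = Submodule.Quotient.mk (1 : A) := by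
    rw [LinearEquiv.symm_apply_eq]
    exact (one_smul A u).symm
  rw [LinearMap.comp_apply, LinearEquiv.coe_coe, this]
  exact one_smul A m

/-- `X` is generated by `u = ε • u` and annihilated by `q`, and is universal with this property;
when `ε` is idempotent this means `X ≅ Aε / AqAε`. -/
structure IsUniversal (q ε : A) (X : Mdl A) (u : X) : Prop where
  fix : ε • u = u
  kill : ∀ x : X, q • x = 0
  gen : ∀ x : X, ∃ a : A, a • u = x
  lift : ∀ a : A, a • u = 0 → ∀ M : Mdl A, (∀ m : M, q • m = 0) → ∀ m : M, ε • m = m → a • m = 0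

namespace IsUniversal

variable {q ε : A} {X : Mdl A} {u : X}

theorem exists_hom (hX : IsUniversal q ε X u) {M : Mdl A} (hM : ∀ m : M, q • m = 0) {m : M}
    (hm : ε • m = m) : ∃ f : X →ₗ[A] M, f u = m :=
  exists_hom_of_cyclic hX.gen fun a ha => hX.lift a ha M hM m hm

theorem finite (hX : IsUniversal q ε X u) : Module.Finite A X :=
  Module.Finite.of_surjective (LinearMap.toSpanSingleton A X u) fun x => hX.gen x

theorem exists_section (hX : IsUniversal q ε X u) (hε : ε * ε = ε) {E : Mdl A}
    (hE : ∀ x : E, q • x = 0) (g : E →ₗ[A] X) (hg : Function.Surjective g) :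
    ∃ s : X →ₗ[A] E, g.comp s = LinearMap.id := by
  obtain ⟨x, hx⟩ := hg u
  obtain ⟨s, hs⟩ := hX.exists_hom hE (m := ε • x) (by rw [← mul_smul, hε])
  refine ⟨s, LinearMap.ext fun y => ?_⟩
  obtain ⟨a, rfl⟩ := hX.gen y
  rw [map_smul, map_smul, LinearMap.comp_apply, hs, map_smul, hx, hX.fix, LinearMap.id_apply]

theorem ext1Vanish (hX : IsUniversal q ε X u) (hq : q * q = q) (hε : ε * ε = ε) {Y : Mdl A}
    (hY : ∀ y : Y, q • y = 0) : Ext1Vanish X Y := fun _ f g _ hg hfg =>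
  hX.exists_section hε (kill_of_extension hq f g hfg hY hX.kill) g hg

theorem isTauRigid (hX : IsUniversal q ε X u) (hq : q * q = q) (hε : ε * ε = ε) :
    IsTauRigid X :=
  ⟨hX.finite, fun _ hY => hX.ext1Vanish hq hε (hY.kill hX.kill)⟩

theorem memFac (hX : IsUniversal q 1 X u) {M : Mdl A} [Module.Finite A M]
    (hM : ∀ m : M, q • m = 0) : MemFac X M := by
  obtain ⟨n, s, hs⟩ := Module.Finite.exists_fin (R := A) (M := M)
  choose f hf using fun t => hX.exists_hom hM (one_smul A (s t))
  refine memFac_of_family f fun x => ?_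
  obtain ⟨c, hc⟩ := (Submodule.mem_span_range_iff_exists_fun A).1 (hs ▸ Submodule.mem_top (x := x))
  exact ⟨fun t => c t • u, by simp only [map_smul, hf, hc]⟩

theorem span (hX : IsUniversal q 1 X u) (hε : ε * ε = ε) :
    IsUniversal q ε (ModuleCat.of A (Submodule.span A {ε • u}))
      ⟨ε • u, Submodule.mem_span_singleton_self _⟩ where
  fix := Subtype.ext (by simp [← mul_smul, hε])
  kill x := Subtype.ext (hX.kill x.1)
  gen x := by
    obtain ⟨a, ha⟩ := Submodule.mem_span_singleton.1 x.2
    exact ⟨a, Subtype.ext ha⟩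
  lift a ha M hM m hm := by
    rw [← hm, ← mul_smul]
    refine hX.lift (a * ε) ?_ M hM m (one_smul _ _)
    rw [mul_smul]
    exact congrArg Subtype.val ha

end IsUniversal

end Universal

section Indecomposable

variable {A : Type} [Ring A]

/-- `x` or `ε - x` is invertible in the corner `εAε`, for every `x`. -/
def IsLocalIdem (ε : A) : Prop :=
  ∀ x, ε * x * ε = x → (∃ y, y * x = ε) ∨ ∃ y, y * (ε - x) = ε

theorem IsBasicFamily.isLocalIdem {ι : Type} [Fintype ι] {e : ι → A} (he : IsBasicFamily e)
    (K : Type) [Field K] [Algebra K A] [FiniteDimensional K A] (k : ι) : IsLocalIdem (e k) := by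
  intro x hx
  rcases (he.prim k).nilpotent_or_unit K hx with hn | ⟨y, hy, -⟩
  · right
    obtain ⟨y, hy⟩ := (hn.isUnit_one_sub).exists_left_inv
    refine ⟨e k * y, ?_⟩
    have hkx : e k * x = x := by rw [← hx]; simp only [← mul_assoc, he.idem]
    have hxk : x * e k = x := by rw [← hx]; simp only [mul_assoc, he.idem]
    have : e k - x = (1 - x) * e k := by rw [sub_mul, one_mul, hxk]
    rw [this, mul_assoc, ← mul_assoc y, hy, one_mul, he.idem]
  · exact Or.inl ⟨y, hy⟩

/-- A module generated by an element fixed by a local idempotent has a unique maximal submodule. -/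
theorem IsLocalIdem.eq_top_or {ε : A} (hl : IsLocalIdem ε) (hε : ε * ε = ε) {X : Mdl A} {u : X}
    (hu : ε • u = u) (hgen : ∀ x : X, ∃ a : A, a • u = x) {N N' : Submodule A X}
    (h : N ⊔ N' = ⊤) : N = ⊤ ∨ N' = ⊤ := by
  have top : ∀ L : Submodule A X, u ∈ L → L = ⊤ := fun L hL => by
    refine eq_top_iff.2 fun x _ => ?_
    obtain ⟨a, rfl⟩ := hgen x
    exact L.smul_mem a hL
  obtain ⟨n, hn, n', hn', hsum⟩ := Submodule.mem_sup.1 (h ▸ Submodule.mem_top (x := u))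
  obtain ⟨a, rfl⟩ := hgen n
  have h1 : (ε * a * ε) • u = ε • a • u := by rw [mul_smul, mul_smul, hu]
  have h2 : (ε - ε * a * ε) • u = ε • n' := by
    rw [sub_smul, h1, ← smul_sub, eq_sub_of_add_eq' hsum]
  rcases hl (ε * a * ε) (by simp only [mul_assoc, hε, ← mul_assoc ε ε]) with ⟨y, hy⟩ | ⟨y, hy⟩
  · refine Or.inl (top N ?_)
    rw [← hu, ← hy, mul_smul, h1]
    exact N.smul_mem _ (N.smul_mem _ hn)
  · refine Or.inr (top N' ?_)
    rw [← hu, ← hy, mul_smul, h2]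
    exact N'.smul_mem _ (N'.smul_mem _ hn')

theorem IsIndec.of_cyclic {ε : A} (hl : IsLocalIdem ε) (hε : ε * ε = ε) {X : Mdl A} {u : X}
    (hu : ε • u = u) (hgen : ∀ x : X, ∃ a : A, a • u = x) (h0 : u ≠ 0) : IsIndec X := by
  refine ⟨⟨u, 0, h0⟩, fun N N' h => ?_⟩
  rcases hl.eq_top_or hε hu hgen h.sup_eq_top with rfl | rfl
  · exact Or.inr (top_inf_eq N' ▸ h.inf_eq_bot)
  · exact Or.inl (inf_top_eq N ▸ h.inf_eq_bot)

theorem IsIndec.of_equiv {M N : Mdl A} (φ : M ≃ₗ[A] N) (hM : IsIndec M) : IsIndec N := by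
  obtain ⟨hnt, h⟩ := hM
  refine ⟨φ.symm.toEquiv.nontrivial, fun L L' hL => ?_⟩
  let σ := (Submodule.orderIsoMapComap φ).symm
  exact (h _ _ (σ.isCompl hL)).imp (fun h => (map_eq_bot_iff σ).1 h) fun h => (map_eq_bot_iff σ).1 h

/-- `M` is a basic module with `Nat.card κ` indecomposable summands. -/
theorem hasNumSummands_and_isBasicMod {κ : Type} [Finite κ] {M : Mdl A} (F : κ → Submodule A M)
    (hind : iSupIndep F) (htop : iSup F = ⊤) (hF : ∀ k, IsIndec (ModuleCat.of A (F k)))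
    (hne : ∀ k l, k ≠ l → IsEmpty (F k ≃ₗ[A] F l)) :
    HasNumSummands M (Nat.card κ) ∧ IsBasicMod M := by
  let σ := (Finite.equivFin κ).symm
  have hdec : IsDecompOf M (F ∘ σ) :=
    ⟨hind.comp σ.injective, by rw [← htop]; exact σ.iSup_comp, fun k => hF _⟩
  exact ⟨⟨_, hdec⟩, _, _, hdec, fun k l hkl => hne _ _ (σ.injective.ne hkl)⟩

end Indecomposable

theorem eq_zero_of_smul_eq_self {A : Type} [Ring A] {M : Type} [AddCommGroup M] [Module A M] {m : M}
    {r : A} (hr : r ∈ Ring.jacobson A) (h : r • m = m) : m = 0 := by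
  rw [← Ideal.jacobson_bot] at hr
  obtain ⟨z, hz⟩ := Ideal.mem_jacobson_iff.1 hr (-1)
  have h1 : z * (1 - r) = 1 := by
    rw [Ideal.mem_bot] at hz
    rw [← sub_eq_zero, ← hz]
    noncomm_ring
  rw [← one_smul A m, ← h1, mul_smul, sub_smul, h, one_smul, sub_self, smul_zero]

section SupportTauTilting

variable {A : Type} [Ring A] {ι : Type}

/-- The support of a module with respect to a family of idempotents. -/
def supp (e : ι → A) (M : Mdl A) : Set ι := {k | ∃ m : M, e k • m ≠ 0}

/-- Basic support τ-tilting modules, over an arbitrary ring. -/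
def IsBasicSTT (e : ι → A) (M : Mdl A) : Prop :=
  (Module.Finite A M ∧ IsTauRigid M ∧ HasNumSummands M (supp e M).ncard) ∧ IsBasicMod M

theorem isBasicSTT_of_family {e : ι → A} {κ : Type} [Finite κ] {M : Mdl A} (hM : IsTauRigid M)
    (F : κ → Submodule A M) (hind : iSupIndep F) (htop : iSup F = ⊤)
    (hF : ∀ k, IsIndec (ModuleCat.of A (F k))) (hne : ∀ k l, k ≠ l → IsEmpty (F k ≃ₗ[A] F l))
    (hcard : (supp e M).ncard = Nat.card κ) : IsBasicSTT e M := by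
  obtain ⟨h1, h2⟩ := hasNumSummands_and_isBasicMod F hind htop hF hne
  exact ⟨⟨hM.1, hM, hcard ▸ h1⟩, h2⟩

variable [Fintype ι] {e : ι → A} (K : Type) [Field K] [Algebra K A] [FiniteDimensional K A]

namespace IsBasicFamily

theorem sum_mul (he : IsBasicFamily e) {S : Finset ι} {k : ι} (hk : k ∈ S) :
    (∑ l ∈ S, e l) * e k = e k := by
  rw [Finset.sum_mul, Finset.sum_eq_single k (fun l _ hl => he.orth hl) (fun h => absurd hk h),
    he.idem]

theorem idem_compl (he : IsBasicFamily e) (S : Finset ι) :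
    (1 - ∑ k ∈ S, e k) * (1 - ∑ k ∈ S, e k) = 1 - ∑ k ∈ S, e k := by
  have : IsIdempotentElem (∑ k ∈ S, e k) := by
    rw [IsIdempotentElem, Finset.mul_sum]
    exact Finset.sum_congr rfl fun k hk => he.sum_mul hk
  exact this.one_sub

theorem mul_sum_of_notMem (he : IsBasicFamily e) {S : Finset ι} {k : ι} (hk : k ∉ S) :
    e k * (∑ l ∈ S, e l) = 0 := by
  rw [Finset.mul_sum]
  exact Finset.sum_eq_zero fun l hl => he.orth fun h => hk (h ▸ hl)

variable {S : Finset ι} {X : Mdl A} {u : X}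

theorem smul_eq_zero_of_notMem (he : IsBasicFamily e) {M : Mdl A}
    (hM : ∀ m : M, (1 - ∑ k ∈ S, e k) • m = 0) {k : ι} (hk : k ∉ S) (m : M) : e k • m = 0 := by
  have : e k = e k * (1 - ∑ k ∈ S, e k) := by rw [mul_sub, mul_one, he.mul_sum_of_notMem hk, sub_zero]
  rw [this, mul_smul, hM, smul_zero]

omit [Fintype ι] in
theorem sum_smul {M : Mdl A} (hM : ∀ m : M, (1 - ∑ k ∈ S, e k) • m = 0) (m : M) :
    ∑ k ∈ S, e k • m = m := by
  have := hM m
  rw [sub_smul, one_smul, sub_eq_zero, Finset.sum_smul] at this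
  exact this.symm

include K in
theorem corner_mem_jacobson (he : IsBasicFamily e) {k l : ι} (hkl : k ≠ l) (a : A) :
    e k * a * e l ∈ Ring.jacobson A :=
  he.mul_mem_jacobson K hkl (by simp only [← mul_assoc, he.idem])
    (by simp only [mul_assoc, he.idem])

include K in
/-- Each vertex carries a simple module concentrated at it. -/
theorem exists_simple (he : IsBasicFamily e) (k : ι) :
    ∃ (M : Mdl A) (m : M), m ≠ 0 ∧ e k • m = m ∧ ∀ l, l ≠ k → ∀ x : M, e l • x = 0 := by
  have hne : Ideal.span {1 - e k} ≠ ⊤ := fun h => by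
    obtain ⟨b, hb⟩ := Ideal.mem_span_singleton'.1 ((Ideal.eq_top_iff_one _).1 h)
    apply (he.prim k).2.1
    rw [← one_mul (e k), ← hb, mul_assoc, sub_mul, one_mul, he.idem, sub_self, mul_zero]
  obtain ⟨L, hL, hle⟩ := Ideal.exists_le_maximal _ hne
  have hmk : ∀ a : A, (Submodule.Quotient.mk a : A ⧸ L) = a • Submodule.Quotient.mk (1 : A) :=
    fun a => by rw [← Submodule.Quotient.mk_smul, smul_eq_mul, mul_one]
  have hm0 : (Submodule.Quotient.mk (1 : A) : A ⧸ L) ≠ 0 := fun h =>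
    hL.ne_top ((Ideal.eq_top_iff_one L).2 ((Submodule.Quotient.mk_eq_zero L).1 h))
  have hkm : e k • (Submodule.Quotient.mk (1 : A) : A ⧸ L) = Submodule.Quotient.mk (1 : A) := by
    rw [← hmk, eq_comm, Submodule.Quotient.eq]
    exact hle (Ideal.mem_span_singleton_self _)
  refine ⟨ModuleCat.of A (A ⧸ L), Submodule.Quotient.mk (1 : A), hm0, hkm, fun l hl x => ?_⟩
  obtain ⟨b, rfl⟩ := Submodule.Quotient.mk_surjective L x
  have hmem : e l * b * e k ∈ L := Ring.jacobson_le_of_isMaximal L (he.corner_mem_jacobson K hl b)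
  calc e l • (Submodule.Quotient.mk b : A ⧸ L)
      = (e l * b * e k) • Submodule.Quotient.mk (1 : A) := by
        rw [hmk, mul_smul, mul_smul, hkm]
    _ = 0 := by rw [← hmk]; exact (Submodule.Quotient.mk_eq_zero L).2 hmem

include K in
theorem smul_ne_zero (he : IsBasicFamily e) (hX : IsUniversal (1 - ∑ k ∈ S, e k) 1 X u) {k : ι}
    (hk : k ∈ S) : e k • u ≠ 0 := fun h => by
  obtain ⟨M, m, hm0, hkm, hM⟩ := he.exists_simple K k
  refine hm0 (hkm ▸ hX.lift _ h M (fun x => ?_) m (one_smul _ _))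
  have hx : e k • x = x := by
    conv_rhs => rw [← one_smul A x, ← he.sum, Finset.sum_smul]
    exact (Finset.sum_eq_single k (fun l _ hl => hM l hl x) (by simp)).symm
  rw [sub_smul, one_smul, Finset.sum_smul, Finset.sum_eq_single k (fun l _ hl => hM l hl x)
    (fun h => absurd hk h), hx, sub_self]

include K in
theorem isEmpty_equiv (he : IsBasicFamily e) {k l : ι} (hkl : k ≠ l) {M N : Mdl A} {m : M} {n : N}
    (hm : e k • m = m) (hn : e l • n = n) (hM : ∀ x : M, ∃ a : A, a • m = x)
    (hN : ∀ x : N, ∃ a : A, a • n = x) (hm0 : m ≠ 0) : IsEmpty (M ≃ₗ[A] N) := by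
  refine ⟨fun φ => hm0 ?_⟩
  obtain ⟨a, ha⟩ := hN (φ m)
  obtain ⟨b, hb⟩ := hM (φ.symm n)
  refine eq_zero_of_smul_eq_self (Ideal.mul_mem_right b _ (he.corner_mem_jacobson K hkl a)) ?_
  apply φ.injective
  rw [mul_smul, mul_smul, mul_smul, hb, map_smul, map_smul, map_smul, φ.apply_symm_apply, hn, ha,
    ← map_smul, hm]

include K in
theorem isBasicSTT (he : IsBasicFamily e) (hX : IsUniversal (1 - ∑ k ∈ S, e k) 1 X u) :
    IsBasicSTT e X := by
  choose ρ hρ using fun k : S => hX.exists_hom hX.kill (one_smul A (e k • u))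
  have hρ' : ∀ (k : S) (a : A), ρ k (a • u) = (a * e k) • u := fun k a => by
    rw [map_smul, hρ, mul_smul]
  have hsp : ∀ k, IsUniversal (1 - ∑ k ∈ S, e k) (e k)
      (ModuleCat.of A (Submodule.span A {e k • u})) ⟨e k • u, _⟩ := fun k => hX.span (he.idem k)
  have h0 : ∀ k : S, (⟨e k • u, Submodule.mem_span_singleton_self _⟩ :
      Submodule.span A {e k • u}) ≠ 0 := fun k h =>
    he.smul_ne_zero K hX k.2 (congrArg Subtype.val h)
  refine isBasicSTT_of_family (κ := S) (hX.isTauRigid (he.idem_compl S) (one_mul 1))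
    (fun k => Submodule.span A {e k • u}) ?_ ?_
    (fun k => IsIndec.of_cyclic (he.isLocalIdem K k) (he.idem k) (hsp k).fix (hsp k).gen (h0 k))
    (fun k l hkl => he.isEmpty_equiv K (fun h => hkl (Subtype.ext h)) (hsp k).fix (hsp l).fix
      (hsp k).gen (hsp l).gen (h0 k)) ?_
  · intro k
    rw [Submodule.disjoint_def]
    intro x hx hx'
    obtain ⟨a, rfl⟩ := Submodule.mem_span_singleton.1 hx
    have h1 : ρ k (a • e k • u) = a • e k • u := by
      rw [← mul_smul, hρ', mul_assoc, he.idem]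
    have h2 : (⨆ l, ⨆ (_ : l ≠ k), Submodule.span A {e l • u}) ≤ LinearMap.ker (ρ k) := by
      refine iSup₂_le fun l hl => ?_
      rw [Submodule.span_singleton_le_iff_mem, LinearMap.mem_ker, hρ',
        he.orth fun h => hl (Subtype.ext h), zero_smul]
    rw [← h1]
    exact h2 hx'
  · refine eq_top_iff.2 fun x _ => ?_
    obtain ⟨a, rfl⟩ := hX.gen x
    have hmem : ∑ k ∈ S, e k • u ∈ ⨆ k : S, Submodule.span A {e k • u} :=
      Submodule.sum_mem _ fun k hk =>
        Submodule.mem_iSup_of_mem (⟨k, hk⟩ : S) (Submodule.mem_span_singleton_self _)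
    rw [sum_smul hX.kill] at hmem
    exact Submodule.smul_mem _ a hmem
  · have : supp e X = S := by
      ext k
      constructor
      · rintro ⟨m, hm⟩
        by_contra hk
        exact hm (he.smul_eq_zero_of_notMem hX.kill hk m)
      · exact fun hk => ⟨u, he.smul_ne_zero K hX hk⟩
    rw [this, Set.ncard_coe_finset, Nat.card_eq_fintype_card, Fintype.card_coe]

end IsBasicFamily

end SupportTauTilting

section Cover

variable {A : Type} [Ring A]

theorem IsTauRigid.memFac_of_exact {C Y E Z : Mdl A} (hC : IsTauRigid C) (f : Y →ₗ[A] E)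
    (g : E →ₗ[A] Z) (hg : Function.Surjective g) (hfg : LinearMap.range f = LinearMap.ker g)
    (hY : MemFac C Y) (hZ : MemFac C Z) : MemFac C E := by
  refine hC.memFac_of_extension (LinearMap.ker g) ?_ ?_
  · refine hY.trans (memFac_of_surjective
      (f.codRestrict (LinearMap.ker g) fun y => hfg ▸ LinearMap.mem_range_self f y) fun x => ?_)
    have hx : (x : E) ∈ LinearMap.range f := hfg.symm ▸ x.2
    obtain ⟨y, hy⟩ := hx
    exact ⟨y, Subtype.ext hy⟩
  · exact hZ.trans (memFac_of_surjective (X := ModuleCat.of A (E ⧸ LinearMap.ker g))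
      (g.quotKerEquivOfSurjective hg).symm.toLinearMap
      (g.quotKerEquivOfSurjective hg).symm.surjective)

theorem exists_smul_eq_of_isSimpleModule {S : Mdl A} [IsSimpleModule A S] {s : S} (hs : s ≠ 0)
    (x : S) : ∃ a : A, a • s = x :=
  Submodule.mem_span_singleton.1
    ((IsSimpleModule.span_singleton_eq_top A hs).symm ▸ Submodule.mem_top)

/-- A local idempotent acts nontrivially on at most one simple module. -/
theorem IsLocalIdem.memFac_of_isSimpleModule {ε : A} (hl : IsLocalIdem ε) (hε : ε * ε = ε)
    {S T : Mdl A} [IsSimpleModule A S] [IsSimpleModule A T] {s : S} {t : T} (hs : ε • s = s)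
    (ht : ε • t = t) (hs0 : s ≠ 0) (ht0 : t ≠ 0) : MemFac S T := by
  obtain ⟨f, hf⟩ := exists_hom_of_cyclic (exists_smul_eq_of_isSimpleModule hs0) (m := t)
    fun a ha => by
      by_contra hat
      obtain ⟨b, hb⟩ := exists_smul_eq_of_isSimpleModule hat t
      have hxs : (ε * (b * a) * ε) • s = 0 := by
        rw [mul_smul, mul_smul, mul_smul, hs, ha, smul_zero, smul_zero]
      have hxt : (ε * (b * a) * ε) • t = t := by
        rw [mul_smul, mul_smul, mul_smul, ht, hb, ht]
      rcases hl (ε * (b * a) * ε) (by simp only [← mul_assoc, hε]; simp only [mul_assoc, hε])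
        with ⟨y, hy⟩ | ⟨y, hy⟩
      · exact hs0 (by rw [← hs, ← hy, mul_smul, hxs, smul_zero])
      · exact ht0 (by rw [← ht, ← hy, mul_smul, sub_smul, hxt, ht, sub_self, smul_zero])
  refine memFac_of_surjective f fun x => ?_
  obtain ⟨a, ha⟩ := exists_smul_eq_of_isSimpleModule ht0 x
  exact ⟨a • s, by rw [map_smul, hf, ha]⟩

/-- The factor modules of a τ-rigid module `C` contain every finite length module all of whose
composition factors they contain. -/
theorem IsTauRigid.memFac_of_simples {C X : Mdl A} (hC : IsTauRigid C) [IsArtinian A X]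
    [IsNoetherian A X]
    (h : ∀ (U : Submodule A X) (L : Submodule A U), IsCoatom L →
      MemFac C (ModuleCat.of A (U ⧸ L))) : MemFac C X := by
  obtain ⟨U, hU, hmin⟩ := IsArtinian.set_has_minimal
    {U : Submodule A X | MemFac C (ModuleCat.of A (X ⧸ U))}
    ⟨⊤, memFac_of_surjective 0 fun x => ⟨0, Subsingleton.elim (α := X ⧸ (⊤ : Submodule A X)) _ _⟩⟩
  rcases eq_or_ne U ⊥ with rfl | hU0
  · exact hU.trans (memFac_of_surjective (Submodule.quotEquivOfEqBot ⊥ rfl).toLinearMap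
      (Submodule.quotEquivOfEqBot ⊥ rfl).surjective)
  · have : Nontrivial U := Submodule.nontrivial_iff_ne_bot.2 hU0
    obtain ⟨L, hL, -⟩ := (eq_top_or_exists_le_coatom (⊥ : Submodule A U)).resolve_left bot_ne_top
    have hlt : L.map U.subtype < U := by
      refine lt_of_le_of_ne (Submodule.map_subtype_le U L) fun heq => hL.1 ?_
      apply Submodule.map_injective_of_injective U.injective_subtype
      rw [heq, Submodule.map_subtype_top]
    refine (hmin _ ?_ hlt).elim
    refine hC.memFac_of_exact (E := ModuleCat.of A (X ⧸ L.map U.subtype))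
      (L.mapQ (L.map U.subtype) U.subtype (Submodule.le_comap_map _ _))
      (Submodule.factor hlt.le) (Submodule.factor_surjective hlt.le) ?_ (h U L hL) hU
    ext x
    obtain ⟨x, rfl⟩ := Submodule.Quotient.mk_surjective _ x
    constructor
    · rintro ⟨y, hy⟩
      obtain ⟨y, rfl⟩ := Submodule.Quotient.mk_surjective _ y
      rw [← hy]
      exact (Submodule.Quotient.mk_eq_zero U).2 y.2
    · intro hx
      exact ⟨Submodule.Quotient.mk ⟨x, (Submodule.Quotient.mk_eq_zero U).1 hx⟩, rfl⟩

variable {ι : Type} [Fintype ι] {e : ι → A} (K : Type) [Field K] [Algebra K A]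
  [FiniteDimensional K A]

namespace IsBasicFamily

theorem smul_eq_zero_of_support {S : Finset ι} (he : IsBasicFamily e) {M : Mdl A}
    (h : ∀ k, k ∉ S → ∀ m : M, e k • m = 0) (m : M) : (1 - ∑ k ∈ S, e k) • m = 0 := by
  rw [← he.sum, sub_smul, Finset.sum_smul, Finset.sum_smul, sub_eq_zero, eq_comm]
  exact Finset.sum_subset (Finset.subset_univ S) fun k _ hk => h k hk m

theorem exists_smul_eq_self (he : IsBasicFamily e) (M : Mdl A) [Nontrivial M] :
    ∃ (k : ι) (m : M), m ≠ 0 ∧ e k • m = m := by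
  obtain ⟨m, hm⟩ := exists_ne (0 : M)
  by_contra! h
  apply hm
  rw [← one_smul A m, ← he.sum, Finset.sum_smul]
  refine Finset.sum_eq_zero fun k _ => ?_
  by_contra hk
  exact h k (e k • m) hk (by rw [← mul_smul, he.idem])

variable {i j : ι} {X Y : Mdl A} {u : X} {v : Y}

include K in
theorem facLT_of_universal [DecidableEq ι] (he : IsBasicFamily e) (hij : i ≠ j)
    (hX : IsUniversal (1 - ∑ k ∈ {i, j}, e k) 1 X u)
    (hY : IsUniversal (1 - ∑ k ∈ {j}, e k) 1 Y v) : FacLT Y X := by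
  have := hY.finite
  refine ⟨facLE_iff.2 (hX.memFac (he.smul_eq_zero_of_support fun k hk =>
    he.smul_eq_zero_of_notMem hY.kill (by simp_all))), fun h => ?_⟩
  exact he.smul_ne_zero K hX (k := i) (by simp)
    ((facLE_iff.1 h).kill (he.smul_eq_zero_of_notMem hY.kill (by simpa using hij)) u)

include K in
theorem hArrow_of_forall [DecidableEq ι] (he : IsBasicFamily e) (hij : i ≠ j)
    (hX : IsUniversal (1 - ∑ k ∈ {i, j}, e k) 1 X u)
    (hY : IsUniversal (1 - ∑ k ∈ {j}, e k) 1 Y v) (h : ∀ a, (e i * a * e j) • u = 0) :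
    HArrow (IsBasicSTT e) X Y := by
  have : IsArtinianRing A := IsArtinianRing.of_finite K A
  refine ⟨he.isBasicSTT K hX, he.isBasicSTT K hY, he.facLT_of_universal K hij hX hY, ?_⟩
  intro C hC hYC hCX
  obtain ⟨⟨hfin, hrig, -⟩, -⟩ := hC
  rw [FacLT, facLE_iff, facLE_iff] at hYC hCX
  have hCk : ∀ c : C, (1 - ∑ k ∈ {i, j}, e k) • c = 0 := hCX.1.kill hX.kill
  have := hX.finite
  have := hY.finite
  have simple : ∀ k ∈ ({i, j} : Finset ι), ∃ (S : Mdl A) (s : S), IsSimpleModule A S ∧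
      MemFac C S ∧ s ≠ 0 ∧ e k • s = s := by
    have hi : ∃ (S : Mdl A) (s : S), IsSimpleModule A S ∧ MemFac C S ∧ s ≠ 0 ∧ e i • s = s := by
      let N : Submodule A C := Submodule.span A (Set.range fun c : C => e j • c)
      have key : ∀ x ∈ N, ∀ a, (e i * a) • x = 0 := fun x hx => by
        induction hx using Submodule.span_induction with
        | mem x hx =>
          obtain ⟨c, rfl⟩ := hx
          intro a
          rw [← mul_smul]
          exact hX.lift _ (h a) C hCk c (one_smul _ _)
        | zero => simp
        | add x y _ _ hx hy => exact fun a => by rw [smul_add, hx, hy, add_zero]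
        | smul b x _ hx => exact fun a => by rw [← mul_smul, mul_assoc, hx]
      have hN : N ≠ ⊤ := fun htop => by
        refine hYC.2 (hY.memFac (he.smul_eq_zero_of_support fun k hk m => ?_))
        rcases eq_or_ne k i with rfl | hki
        · rw [← mul_one (e k)]
          exact key m (htop ▸ Submodule.mem_top) 1
        · exact he.smul_eq_zero_of_notMem hCk (by simp_all) m
      obtain ⟨L, hL, hNL⟩ := (eq_top_or_exists_le_coatom N).resolve_left hN
      have hS : IsSimpleModule A (C ⧸ L) := isSimpleModule_iff_isCoatom.2 hL
      have hnt := IsSimpleModule.nontrivial A (C ⧸ L)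
      have hCS : MemFac C (ModuleCat.of A (C ⧸ L)) := memFac_of_surjective _ L.mkQ_surjective
      obtain ⟨k, s, hs0, hs⟩ := he.exists_smul_eq_self (ModuleCat.of A (C ⧸ L))
      have hk : k = i := by
        by_contra hki
        apply hs0
        rcases eq_or_ne k j with rfl | hkj
        · obtain ⟨c, rfl⟩ := L.mkQ_surjective s
          rw [← hs]
          exact (Submodule.Quotient.mk_eq_zero L).2 (hNL (Submodule.subset_span ⟨c, rfl⟩))
        · rw [← hs]
          exact he.smul_eq_zero_of_notMem (hCS.kill hCk) (by simp_all) s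
      exact ⟨_, s, hS, hCS, hs0, hk ▸ hs⟩
    have hj : ∃ (S : Mdl A) (s : S), IsSimpleModule A S ∧ MemFac C S ∧ s ≠ 0 ∧ e j • s = s := by
      have : Nontrivial Y := ⟨e j • v, 0, he.smul_ne_zero K hY (by simp)⟩
      obtain ⟨L, hL, -⟩ := (eq_top_or_exists_le_coatom (⊥ : Submodule A Y)).resolve_left bot_ne_top
      have hS : IsSimpleModule A (Y ⧸ L) := isSimpleModule_iff_isCoatom.2 hL
      have hnt := IsSimpleModule.nontrivial A (Y ⧸ L)
      have hYS : MemFac Y (ModuleCat.of A (Y ⧸ L)) := memFac_of_surjective _ L.mkQ_surjective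
      obtain ⟨k, s, hs0, hs⟩ := he.exists_smul_eq_self (ModuleCat.of A (Y ⧸ L))
      have hk : k = j := by
        by_contra hkj
        exact hs0 (hs ▸ he.smul_eq_zero_of_notMem (hYS.kill hY.kill) (by simpa using hkj) s)
      exact ⟨_, s, hS, hYC.1.trans hYS, hs0, hk ▸ hs⟩
    intro k hk
    rcases Finset.mem_insert.1 hk with rfl | hk
    · exact hi
    · exact Finset.mem_singleton.1 hk ▸ hj
  refine hCX.2 (hrig.memFac_of_simples fun U L hL => ?_)
  have hS : IsSimpleModule A (U ⧸ L) := isSimpleModule_iff_isCoatom.2 hL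
  have hnt := IsSimpleModule.nontrivial A (U ⧸ L)
  obtain ⟨k, s, hs0, hs⟩ := he.exists_smul_eq_self (ModuleCat.of A (U ⧸ L))
  have hkill : ∀ x : ModuleCat.of A (U ⧸ L), (1 - ∑ k ∈ {i, j}, e k) • x = 0 := fun x => by
    obtain ⟨x, rfl⟩ := L.mkQ_surjective x
    rw [← map_smul, (Subtype.ext (hX.kill x.1) : (1 - ∑ k ∈ {i, j}, e k) • x = 0), map_zero]
  have hk : k ∈ ({i, j} : Finset ι) := by
    by_contra hk
    exact hs0 (hs ▸ he.smul_eq_zero_of_notMem hkill hk s)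
  obtain ⟨T, t, hT, hCT, ht0, ht⟩ := simple k hk
  exact hCT.trans ((he.isLocalIdem K k).memFac_of_isSimpleModule (he.idem k) ht hs ht0 hs0)

end IsBasicFamily

end Cover

section MinimalFamily

variable {A : Type} [Ring A] {δ ε q : A} {P : Mdl A} {p : P} {m : ℕ} {f : Fin m → P}

/-- `f` minimally generates `δP` as a module over the endomorphism ring of `P`. -/
structure IsMinimalFamily (δ : A) (f : Fin m → P) : Prop where
  fix : ∀ l, δ • f l = f l
  gen : ∀ x : P, δ • x = x → ∃ g : Fin m → P →ₗ[A] P, ∑ l, g l (f l) = x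
  min : ∀ g : Fin m → P →ₗ[A] P, ∑ l, g l (f l) = 0 → ∀ l, ¬ Function.Bijective (g l)

theorem exists_isMinimalFamily {n : ℕ} (f : Fin n → P) (hfix : ∀ l, δ • f l = f l)
    (hgen : ∀ x : P, δ • x = x → ∃ g : Fin n → P →ₗ[A] P, ∑ l, g l (f l) = x) :
    ∃ (m : ℕ) (f : Fin m → P), IsMinimalFamily δ f := by
  classical
  have hex : ∃ n, ∃ f : Fin n → P, (∀ l, δ • f l = f l) ∧
      ∀ x : P, δ • x = x → ∃ g : Fin n → P →ₗ[A] P, ∑ l, g l (f l) = x := ⟨n, f, hfix, hgen⟩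
  obtain ⟨f, hfix, hgen⟩ := Nat.find_spec hex
  have hmin := fun k => Nat.find_min hex (m := k)
  generalize Nat.find hex = m at f hfix hgen hmin
  refine ⟨m, f, hfix, hgen, fun g hg l hl => ?_⟩
  obtain _ | m := m
  · exact l.elim0
  refine hmin m (Nat.lt_succ_self m) ⟨f ∘ l.succAbove, fun k => hfix _, fun x hx => ?_⟩
  obtain ⟨c, hc⟩ := hgen x hx
  let ψ := (LinearEquiv.ofBijective (g l) hl).symm.toLinearMap
  have hψ : ψ (g l (f l)) = f l := (LinearEquiv.ofBijective (g l) hl).symm_apply_apply (f l)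
  rw [Fin.sum_univ_succAbove _ l] at hg hc
  refine ⟨fun k => c (l.succAbove k) - (c l).comp (ψ.comp (g (l.succAbove k))), ?_⟩
  simp only [LinearMap.sub_apply, LinearMap.comp_apply, Function.comp_apply,
    Finset.sum_sub_distrib, ← map_sum]
  rw [eq_neg_of_add_eq_zero_right hg, map_neg, map_neg, hψ, ← hc]
  abel

theorem IsUniversal.exists_isMinimalFamily (K : Type) [Field K] [Algebra K A]
    [FiniteDimensional K A] (hP : IsUniversal q ε P p) (hδ : δ * δ = δ) :
    ∃ (m : ℕ) (f : Fin m → P), IsMinimalFamily δ f := by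
  obtain ⟨n, s, hs⟩ := Module.Finite.exists_fin (R := K) (M := A)
  refine TauTilting.exists_isMinimalFamily (fun t => (δ * s t) • p)
    (fun t => by rw [← mul_smul, ← mul_assoc, hδ]) fun x hx => ?_
  obtain ⟨a, rfl⟩ := hP.gen x
  obtain ⟨c, rfl⟩ := (Submodule.mem_span_range_iff_exists_fun K).1 (hs ▸ Submodule.mem_top (x := a))
  choose g hg using fun t => hP.exists_hom hP.kill (m := algebraMap K A (c t) • p)
    (by rw [← mul_smul, ← Algebra.commutes, mul_smul, hP.fix])
  refine ⟨g, ?_⟩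
  rw [← hx, ← mul_smul, Finset.mul_sum, Finset.sum_smul]
  refine Finset.sum_congr rfl fun t _ => ?_
  rw [map_smul, hg, ← mul_smul, ← Algebra.commutes, Algebra.smul_def, ← mul_assoc,
    ← mul_assoc, Algebra.commutes]

theorem IsUniversal.exists_hom_lift (hP : IsUniversal q ε P p) (hε : ε * ε = ε) {E Z : Mdl A}
    (hE : ∀ x : E, q • x = 0) (g : E →ₗ[A] Z) (hg : Function.Surjective g) (φ : P →ₗ[A] Z) :
    ∃ s : P →ₗ[A] E, g.comp s = φ := by
  obtain ⟨x, hx⟩ := hg (φ p)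
  obtain ⟨s, hs⟩ := hP.exists_hom hE (m := ε • x) (by rw [← mul_smul, hε])
  refine ⟨s, LinearMap.ext fun y => ?_⟩
  obtain ⟨a, rfl⟩ := hP.gen y
  rw [map_smul, map_smul, LinearMap.comp_apply, hs, map_smul, hx, ← map_smul, hP.fix]

theorem IsUniversal.exists_pi_lift (hP : IsUniversal q ε P p) (hε : ε * ε = ε) {E Z : Mdl A}
    (hE : ∀ x : E, q • x = 0) (g : E →ₗ[A] Z) (hg : Function.Surjective g)
    (φ : (Fin m → P) →ₗ[A] Z) : ∃ s : (Fin m → P) →ₗ[A] E, g.comp s = φ := by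
  choose s hs using fun k =>
    hP.exists_hom_lift hε hE g hg (φ.comp (LinearMap.single A (fun _ => P) k))
  refine ⟨∑ k, (s k).comp (LinearMap.proj k), LinearMap.ext fun x => ?_⟩
  have h : ∀ k, g (s k (x k)) = φ (LinearMap.single A (fun _ => P) k (x k)) :=
    fun k => congrArg (fun ψ => ψ (x k)) (hs k)
  simp only [LinearMap.comp_apply, LinearMap.sum_apply, map_sum, LinearMap.proj_apply, h]
  rw [← map_sum]
  exact congrArg φ (Finset.univ_sum_single x)

namespace IsMinimalFamily

theorem fix_smul (hf : IsMinimalFamily δ f) : δ • f = f := funext hf.fix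

theorem exists_hom_eq (hf : IsMinimalFamily δ f) (hδ : δ * δ = δ) {Y : Mdl A} (hY : MemFac P Y)
    {y : Y} (hy : δ • y = y) : ∃ θ : (Fin m → P) →ₗ[A] Y, θ f = y := by
  obtain ⟨n, h, hh⟩ := hY
  obtain ⟨x, rfl⟩ := hh y
  choose g hg using fun t => hf.gen (δ • x t) (by rw [← mul_smul, hδ])
  refine ⟨h.comp (LinearMap.pi fun t => ∑ l, (g t l).comp (LinearMap.proj l)), ?_⟩
  rw [← hy, ← map_smul, LinearMap.comp_apply]
  congr 1
  ext t
  simp [hg]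

/-- `F/Af` has the lifting property for extensions by modules in `Fac P`. -/
theorem exists_lift (hf : IsMinimalFamily δ f) (hP : IsUniversal q ε P p) (hε : ε * ε = ε)
    (hδ : δ * δ = δ) {Y E Z : Mdl A} (hY : MemFac P Y) (hE : ∀ x : E, q • x = 0)
    (i : Y →ₗ[A] E) (g : E →ₗ[A] Z) (hg : Function.Surjective g)
    (hig : LinearMap.range i = LinearMap.ker g) (φ : ((Fin m → P) ⧸ A ∙ f) →ₗ[A] Z) :
    ∃ s : ((Fin m → P) ⧸ A ∙ f) →ₗ[A] E, g.comp s = φ := by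
  obtain ⟨s, hs⟩ := hP.exists_pi_lift hε hE g hg (φ.comp (A ∙ f).mkQ)
  have hsf : s f ∈ LinearMap.range i := by
    rw [hig, LinearMap.mem_ker, ← LinearMap.comp_apply, hs, LinearMap.comp_apply,
      Submodule.mkQ_apply, (Submodule.Quotient.mk_eq_zero _).2 (Submodule.mem_span_singleton_self f),
      map_zero]
  obtain ⟨y, hy⟩ := hsf
  obtain ⟨θ, hθ⟩ := hf.exists_hom_eq hδ hY (y := δ • y) (by rw [← mul_smul, hδ])
  have hgi : ∀ y, g (i y) = 0 := fun y => (hig ▸ LinearMap.mem_range_self i y :)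
  refine ⟨(A ∙ f).liftQ (s - i.comp θ) ?_, Submodule.linearMap_qext _ ?_⟩
  · rw [Submodule.span_singleton_le_iff_mem, LinearMap.mem_ker, LinearMap.sub_apply,
      LinearMap.comp_apply, hθ, map_smul, hy, ← map_smul, hf.fix_smul, sub_self]
  · rw [LinearMap.comp_assoc, Submodule.liftQ_mkQ, ← hs]
    refine LinearMap.ext fun x => ?_
    rw [LinearMap.comp_apply, LinearMap.sub_apply, map_sub, LinearMap.comp_apply i, hgi, sub_zero,
      LinearMap.comp_apply]

theorem eq_zero_of_map_eq (hf : IsMinimalFamily δ f) (hP : IsUniversal q ε P p)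
    (hJ : ∀ a, δ * a * ε ∈ Ring.jacobson A) {ψ : (Fin m → P) →ₗ[A] (Fin m → P)}
    (hψ : ∀ x, ψ x ∈ A ∙ f) {y : A} (hy : y • ψ f = f) : f = 0 := by
  choose a ha using fun l => hP.gen (f l)
  choose b hb using fun l =>
    Submodule.mem_span_singleton.1 (hψ (LinearMap.single A (fun _ => P) l p))
  refine eq_zero_of_smul_eq_self (r := ∑ l, y * (δ * a l * ε * b l)) (Ideal.sum_mem _ fun l _ =>
    Ideal.mul_mem_left _ _ (Ideal.mul_mem_right _ _ (hJ (a l)))) ?_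
  have h : f = ∑ l, (δ * a l * ε) • LinearMap.single A (fun _ => P) l p := by
    conv_lhs => rw [← Finset.univ_sum_single f]
    refine Finset.sum_congr rfl fun l _ => ?_
    rw [← map_smul, mul_smul, mul_smul, hP.fix, ha, hf.fix]
    rfl
  conv_rhs => rw [← hy, h]
  rw [Finset.sum_smul, map_sum, Finset.smul_sum]
  refine Finset.sum_congr rfl fun l _ => ?_
  rw [map_smul, ← hb, mul_smul, mul_smul]

/-- An endomorphism of `F` that kills `f` is radical. -/
theorem eq_top_of_map_eq_zero (hf : IsMinimalFamily δ f) (hP : IsUniversal q ε P p)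
    (hrad : ∀ g : P →ₗ[A] P, Function.Bijective g ∨ ∃ r ∈ Ring.jacobson A, g p = r • p)
    {ψ : (Fin m → P) →ₗ[A] (Fin m → P)} (hψ : ψ f = 0) {W : Submodule A (Fin m → P)}
    (hW : ∀ x, x - ψ x ∈ W) : W = ⊤ := by
  have := hP.finite
  let c := fun k l : Fin m => (LinearMap.proj k).comp (ψ.comp (LinearMap.single A (fun _ => P) l))
  have hψc : ∀ x k, ψ x k = ∑ l, c k l (x l) := fun x k => by
    conv_lhs => rw [← Finset.univ_sum_single x, map_sum, Finset.sum_apply]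
    rfl
  have hc : ∀ k l, ∃ r ∈ Ring.jacobson A, c k l p = r • p := fun k l =>
    (hrad _).resolve_left (hf.min (c k) (by rw [← hψc, hψ]; rfl) l)
  choose r hr hcr using hc
  have hmem : ∀ x, ψ x ∈ Ring.jacobson A • (⊤ : Submodule A (Fin m → P)) := fun x => by
    choose a ha using fun l => hP.gen (x l)
    have : ψ x = ∑ k, ∑ l, a l • r k l • LinearMap.single A (fun _ => P) k p := by
      rw [← Finset.univ_sum_single (ψ x)]
      refine Finset.sum_congr rfl fun k _ => ?_
      rw [hψc]
      simp only [← ha, map_smul, hcr, ← Pi.single_smul, LinearMap.coe_single]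
      exact map_sum (LinearMap.single A (fun _ => P) k) _ _
    rw [this]
    exact Submodule.sum_mem _ fun k _ => Submodule.sum_mem _ fun l _ =>
      Submodule.smul_mem _ _ (Submodule.smul_mem_smul (hr k l) trivial)
  have htop : (⊤ : Submodule A ((Fin m → P) ⧸ W)) ≤ Ring.jacobson A • ⊤ := by
    intro x _
    obtain ⟨x, rfl⟩ := W.mkQ_surjective x
    have hx : W.mkQ x = W.mkQ (ψ x) := by
      rw [← sub_eq_zero, ← map_sub]
      exact (Submodule.Quotient.mk_eq_zero W).2 (hW x)
    rw [hx, ← W.range_mkQ, ← Submodule.map_top, ← Submodule.map_smul'']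
    exact Submodule.mem_map_of_mem (hmem x)
  have hbot := Submodule.FG.eq_bot_of_le_jacobson_smul Module.Finite.fg_top htop
  refine eq_top_iff.2 fun x _ => (Submodule.Quotient.mk_eq_zero W).1 ?_
  exact (Submodule.mem_bot A).1 (hbot ▸ Submodule.mem_top)

theorem mkQ_eq_zero_iff {x : Fin m → P} : (A ∙ f).mkQ x = 0 ↔ x ∈ A ∙ f :=
  Submodule.Quotient.mk_eq_zero _

theorem nontrivial_quotient (hf : IsMinimalFamily δ f) (hP : IsUniversal q ε P p)
    (hJ : ∀ a, δ * a * ε ∈ Ring.jacobson A) (hf0 : f ≠ 0) :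
    Nontrivial ((Fin m → P) ⧸ A ∙ f) := by
  by_contra h
  rw [not_nontrivial_iff_subsingleton] at h
  exact hf0 (hf.eq_zero_of_map_eq hP hJ (ψ := LinearMap.id) (y := 1)
    (fun x => mkQ_eq_zero_iff.1 (Subsingleton.elim _ _)) (one_smul _ _))

theorem isEmpty_equiv (hf : IsMinimalFamily δ f) (hP : IsUniversal q ε P p) (hε : ε * ε = ε)
    (hJ : ∀ a, δ * a * ε ∈ Ring.jacobson A) (hf0 : f ≠ 0) :
    IsEmpty (P ≃ₗ[A] ((Fin m → P) ⧸ A ∙ f)) := by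
  refine ⟨fun φ => hf0 ?_⟩
  let g : (Fin m → P) →ₗ[A] P := φ.symm.toLinearMap.comp (A ∙ f).mkQ
  have hg : Function.Surjective g := φ.symm.surjective.comp (A ∙ f).mkQ_surjective
  have hgx : ∀ x, g x = 0 ↔ x ∈ A ∙ f := fun x =>
    (map_eq_zero_iff φ.symm φ.symm.injective).trans mkQ_eq_zero_iff
  obtain ⟨s, hs⟩ := hP.exists_section (E := ModuleCat.of A (Fin m → P)) hε
    (fun x => funext fun k => hP.kill (x k)) g hg
  refine hf.eq_zero_of_map_eq hP hJ (ψ := LinearMap.id - s.comp g) (y := 1) (fun x => ?_) ?_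
  · rw [← hgx, LinearMap.sub_apply, map_sub, LinearMap.comp_apply]
    exact sub_eq_zero.2 (congrArg (fun φ => φ (g x)) hs).symm
  · rw [one_smul, LinearMap.sub_apply, LinearMap.comp_apply,
      (hgx f).2 (Submodule.mem_span_singleton_self f), map_zero, sub_zero, LinearMap.id_apply]

theorem isIndec (hf : IsMinimalFamily δ f) (hP : IsUniversal q ε P p) (hε : ε * ε = ε)
    (hδ : δ * δ = δ) (hJ : ∀ a, δ * a * ε ∈ Ring.jacobson A)
    (hrad : ∀ g : P →ₗ[A] P, Function.Bijective g ∨ ∃ r ∈ Ring.jacobson A, g p = r • p)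
    (hloc : ∀ x, δ * x * δ = x → IsNilpotent x ∨ ∃ y, y * x = δ) (hf0 : f ≠ 0) :
    IsIndec (ModuleCat.of A ((Fin m → P) ⧸ A ∙ f)) := by
  refine ⟨hf.nontrivial_quotient hP hJ hf0, fun N N' hN => ?_⟩
  have aux : ∀ (ψ : Module.End A (Fin m → P)) (π : Module.End A ((Fin m → P) ⧸ A ∙ f)) (x : A)
      (L : Submodule A ((Fin m → P) ⧸ A ∙ f)), (A ∙ f).mkQ.comp ψ = π.comp (A ∙ f).mkQ →
      IsIdempotentElem π → IsNilpotent x → ψ f = x • f → (∀ y, y - π y ∈ L) → L = ⊤ := by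
    intro ψ π x L hψ hπ ⟨n, hn⟩ hx hL
    have hpow : ∀ n, (ψ ^ n) f = x ^ n • f := fun n => by
      induction n with
      | zero => simp
      | succ n ih => rw [pow_succ', pow_succ, Module.End.mul_apply, ih, map_smul, hx, mul_smul]
    have hcomp : ∀ n z, (A ∙ f).mkQ ((ψ ^ n) z) = (π ^ n) ((A ∙ f).mkQ z) := fun n z => by
      induction n with
      | zero => simp
      | succ n ih =>
        rw [pow_succ', pow_succ', Module.End.mul_apply, Module.End.mul_apply, ← ih]
        exact LinearMap.congr_fun hψ _
    have := hf.eq_top_of_map_eq_zero hP hrad (ψ := ψ ^ (n + 1)) (W := L.comap (A ∙ f).mkQ)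
      (by rw [hpow, pow_succ, hn, zero_mul, zero_smul])
      (fun z => by
        rw [Submodule.mem_comap, map_sub, hcomp, hπ.pow_succ_eq]
        exact hL _)
    rw [← Submodule.map_comap_eq_of_surjective (A ∙ f).mkQ_surjective L, this, Submodule.map_top,
      Submodule.range_mkQ]
  let π : Module.End A ((Fin m → P) ⧸ A ∙ f) := N.projection N' hN
  have hπ : IsIdempotentElem π := Submodule.isIdempotentElem_projection hN
  obtain ⟨ψ, hψ⟩ := hP.exists_pi_lift (E := ModuleCat.of A (Fin m → P))
    (Z := ModuleCat.of A ((Fin m → P) ⧸ A ∙ f)) hε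
    (fun x => funext fun k => hP.kill (x k)) (A ∙ f).mkQ (A ∙ f).mkQ_surjective
    (π.comp (A ∙ f).mkQ)
  have hψ' : ∀ z, (A ∙ f).mkQ (ψ z) = π ((A ∙ f).mkQ z) := fun z =>
    LinearMap.congr_fun hψ z
  have hf' : (A ∙ f).mkQ f = 0 := mkQ_eq_zero_iff.2 (Submodule.mem_span_singleton_self f)
  obtain ⟨a, ha⟩ := Submodule.mem_span_singleton.1
    (mkQ_eq_zero_iff.1 (by rw [hψ', hf', map_zero] : (A ∙ f).mkQ (ψ f) = 0))
  have hx : ψ f = (δ * a * δ) • f := by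
    rw [mul_smul, mul_smul, hf.fix_smul, ha, ← map_smul, hf.fix_smul]
  generalize hxa : δ * a * δ = x at hx
  have hδx : δ * x = x := by rw [← hxa]; simp only [← mul_assoc, hδ]
  have hxδ : x * δ = x := by rw [← hxa]; simp only [mul_assoc, hδ]
  rcases hloc x (by rw [hδx, hxδ]) with hn | ⟨y, hy⟩
  · left
    have h : N' = ⊤ := aux ψ π x N' hψ hπ hn hx fun y => by
      rw [← Submodule.projection_apply_eq_zero_iff hN]
      change π (y - π y) = 0
      rw [map_sub, ← Module.End.mul_apply, hπ.eq, sub_self]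
    exact inf_top_eq N ▸ h ▸ hN.inf_eq_bot
  rcases hloc (δ - x) (by simp only [mul_sub, sub_mul, hδ, hδx, hxδ]) with hn | ⟨z, hz⟩
  · right
    have h : N = ⊤ := aux (1 - ψ) (1 - π) (δ - x) N (by
        refine LinearMap.ext fun z => ?_
        exact (map_sub _ _ _).trans (congrArg _ (hψ' z))) hπ.one_sub hn (by
        rw [sub_smul, ← hx, hf.fix_smul]
        rfl) fun y => by
      rw [LinearMap.sub_apply, Module.End.one_apply, sub_sub_cancel]
      exact Submodule.projection_apply_mem hN y
    exact top_inf_eq N' ▸ h ▸ hN.inf_eq_bot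
  · refine absurd (hf.eq_zero_of_map_eq hP hJ (ψ := ψ - ψ * ψ) (y := z * y) (fun w => ?_) ?_) hf0
    · rw [← mkQ_eq_zero_iff, LinearMap.sub_apply, map_sub, Module.End.mul_apply, hψ', hψ', hψ',
        ← Module.End.mul_apply, hπ.eq, sub_self]
    · rw [LinearMap.sub_apply, Module.End.mul_apply, hx, map_smul, hx, ← mul_smul, ← sub_smul,
        ← mul_smul]
      have : z * y * (x - x * x) = δ := by
        have : x - x * x = x * (δ - x) := by rw [mul_sub, hxδ]
        rw [this, mul_assoc, ← mul_assoc y, hy, mul_sub, hδ, hδx, hz]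
      rw [this, hf.fix_smul]

end IsMinimalFamily

end MinimalFamily

section NotCover

variable {A : Type} [Ring A] {ι : Type} [Fintype ι] {e : ι → A} (K : Type) [Field K] [Algebra K A]
  [FiniteDimensional K A]

namespace IsBasicFamily

include K in
theorem bijective_or_exists (he : IsBasicFamily e) {q : A} {l : ι} {P : Mdl A} {p : P}
    (hP : IsUniversal q (e l) P p) (g : P →ₗ[A] P) :
    Function.Bijective g ∨ ∃ r ∈ Ring.jacobson A, g p = r • p := by
  have := hP.finite
  have : IsNoetherianRing A := IsNoetherianRing.of_finite K A
  obtain ⟨a, ha⟩ := hP.gen (g p)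
  have hd : g p = (e l * a * e l) • p := by
    rw [mul_smul, mul_smul, hP.fix, ha, ← map_smul, hP.fix]
  by_cases h : ∃ y, y * (e l * a * e l) = e l
  · obtain ⟨y, hy⟩ := h
    have hsurj : Function.Surjective g := fun x => by
      obtain ⟨b, rfl⟩ := hP.gen x
      exact ⟨b • y • p, by rw [map_smul, map_smul, hd, ← mul_smul y, hy, hP.fix]⟩
    exact Or.inl ⟨IsNoetherian.injective_of_surjective_endomorphism g hsurj, hsurj⟩
  · push Not at h
    exact Or.inr ⟨_, he.mem_jacobson K (by rw [mul_assoc, he.idem]) h, hd⟩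

variable {i j : ι} {X Y : Mdl A} {u : X} {v : Y}

include K in
theorem not_memFac_of_universal [DecidableEq ι] (he : IsBasicFamily e) (hij : i ≠ j)
    (hX : IsUniversal (1 - ∑ k ∈ {i, j}, e k) 1 X u) {P : Mdl A} {p : P} (hp : e j • p = p)
    (hgen : ∀ x : P, ∃ a : A, a • p = x) : ¬ MemFac P X := fun h => by
  obtain ⟨S, s, hs0, -, hS⟩ := he.exists_simple K i
  obtain ⟨φ, hφ⟩ := hX.exists_hom (he.smul_eq_zero_of_support fun k hk => hS k (by simp_all))
    (one_smul A s)
  obtain ⟨n, g, hg⟩ := h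
  obtain ⟨x, rfl⟩ := hg u
  apply hs0
  rw [← hφ, ← LinearMap.comp_apply, ← Finset.univ_sum_single x, map_sum]
  refine Finset.sum_eq_zero fun t _ => ?_
  obtain ⟨a, ha⟩ := hgen (x t)
  have : Pi.single t (x t) = a • e j • (Pi.single t p : Fin n → P) := by
    rw [← Pi.single_smul, ← Pi.single_smul, hp, ha]
  rw [this, map_smul, map_smul, hS j hij.symm, smul_zero]

include K in
theorem exists_isBasicSTT (he : IsBasicFamily e) (hij : i ≠ j) [DecidableEq ι] {P : Mdl A} {p : P}
    (hP : IsUniversal (1 - ∑ k ∈ {i, j}, e k) (e j) P p) (h : ∃ a, (e i * a * e j) • p ≠ 0) :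
    ∃ C : Mdl A, IsBasicSTT e C ∧ MemFac C P ∧ MemFac P C := by
  have hq := he.idem_compl {i, j}
  obtain ⟨m, f, hf⟩ := hP.exists_isMinimalFamily K (he.idem i)
  obtain ⟨a, ha⟩ := h
  have hJ := he.corner_mem_jacobson K hij
  have hrad := he.bijective_or_exists K hP
  have hp0 : p ≠ 0 := fun h => ha (by rw [h, smul_zero])
  have hf0 : f ≠ 0 := fun h => by
    obtain ⟨g, hg⟩ := hf.gen ((e i * a * e j) • p)
      (by rw [← mul_smul, ← mul_assoc, ← mul_assoc, he.idem])
    exact ha (hg ▸ Finset.sum_eq_zero fun l _ => by rw [h, Pi.zero_apply, map_zero])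
  have hNE : IsEmpty (P ≃ₗ[A] ((Fin m → P) ⧸ A ∙ f)) := hf.isEmpty_equiv hP (he.idem j) hJ hf0
  let N : Mdl A := ModuleCat.of A ((Fin m → P) ⧸ A ∙ f)
  have hN : IsIndec N := hf.isIndec hP (he.idem j) (he.idem i) hJ hrad
    (fun x hx => ((he.prim i).nilpotent_or_unit K hx).imp_right fun ⟨y, hy, _⟩ => ⟨y, hy⟩) hf0
  have hPi : IsIndec P :=
    IsIndec.of_cyclic (he.isLocalIdem K j) (he.idem j) hP.fix hP.gen hp0
  have hPC : MemFac P (dsum P N) :=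
    memFac_of_family (κ := Option (Fin m)) (fun t => t.elim (LinearMap.inl A P N) fun l =>
      (LinearMap.inr A P N).comp ((A ∙ f).mkQ.comp (LinearMap.single A (fun _ => P) l)))
      fun x => by
      obtain ⟨y, hy⟩ := (A ∙ f).mkQ_surjective x.2
      have h : ∑ l, LinearMap.inr A P N ((A ∙ f).mkQ (LinearMap.single A (fun _ => P) l (y l))) =
          LinearMap.inr A P N x.2 := by
        rw [← map_sum, ← map_sum, ← hy]
        exact congrArg _ (congrArg _ (Finset.univ_sum_single y))
      refine ⟨fun t => t.elim x.1 y, (Fintype.sum_option _).trans ?_⟩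
      exact (congrArg (LinearMap.inl A P N x.1 + ·) h).trans
        (Prod.ext (add_zero x.1) (zero_add x.2))
  have hCP : MemFac (dsum P N) P := memFac_of_surjective (LinearMap.fst A P N) Prod.fst_surjective
  have hkill := hPC.kill hP.kill
  have := hP.finite
  refine ⟨dsum P N, isBasicSTT_of_family (κ := Bool) ⟨hPC.finite, fun Y hY E f₀ g hf₀ hg hfg => ?_⟩
    (fun b => bif b then LinearMap.range (LinearMap.inl A P N) else
      LinearMap.range (LinearMap.inr A P N)) ?_ ?_ ?_ ?_ ?_, hCP, hPC⟩
  · have hPY := hPC.trans hY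
    have hE := kill_of_extension hq f₀ g hfg (hPY.kill hP.kill) hkill
    obtain ⟨s, hs⟩ := hP.exists_hom_lift (he.idem j) hE g hg (LinearMap.inl A P N)
    obtain ⟨t, ht⟩ := hf.exists_lift hP (he.idem j) (he.idem i) hPY hE f₀ g hg hfg
      (LinearMap.inr A P N)
    refine ⟨s.coprod t, LinearMap.ext fun x => (map_add g (s x.1) (t x.2)).trans ?_⟩
    exact (congrArg₂ (· + ·) (LinearMap.congr_fun hs x.1) (LinearMap.congr_fun ht x.2)).trans
      (Prod.ext (add_zero x.1) (zero_add x.2))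
  · rw [iSupIndep_pair (i := true) (j := false) (by simp) (by simp)]
    exact LinearMap.isCompl_range_inl_inr.disjoint
  · rw [iSup_bool_eq]
    exact LinearMap.isCompl_range_inl_inr.sup_eq_top
  · rintro (_ | _)
    · exact hN.of_equiv (LinearEquiv.ofInjective (LinearMap.inr A P N) LinearMap.inr_injective)
    · exact hPi.of_equiv (LinearEquiv.ofInjective (LinearMap.inl A P N) LinearMap.inl_injective)
  · have h1 := LinearEquiv.ofInjective (LinearMap.inl A P N) LinearMap.inl_injective
    have h2 := LinearEquiv.ofInjective (LinearMap.inr A P N) LinearMap.inr_injective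
    rintro (_ | _) (_ | _) h
    · exact absurd rfl h
    · exact ⟨fun φ => hNE.false ((h2.trans φ).trans h1.symm).symm⟩
    · exact ⟨fun φ => hNE.false ((h1.trans φ).trans h2.symm)⟩
    · exact absurd rfl h
  · have : supp e (dsum P N) = {i, j} := by
      ext k
      constructor
      · rintro ⟨x, hx⟩
        by_contra hk
        exact hx (he.smul_eq_zero_of_notMem hkill (by simpa using hk) x)
      · rintro (rfl | rfl)
        · obtain ⟨l, hl⟩ := Function.ne_iff.1 hf0
          exact ⟨(f l, 0), fun h => hl ((hf.fix l).symm.trans (congrArg Prod.fst h))⟩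
        · exact ⟨(p, 0), fun h => hp0 (hP.fix.symm.trans (congrArg Prod.fst h))⟩
    rw [this, Set.ncard_pair hij, Nat.card_eq_fintype_card, Fintype.card_bool]

include K in
theorem not_hArrow_of_exists [DecidableEq ι] (he : IsBasicFamily e) (hij : i ≠ j)
    (hX : IsUniversal (1 - ∑ k ∈ {i, j}, e k) 1 X u)
    (hY : IsUniversal (1 - ∑ k ∈ {j}, e k) 1 Y v) (h : ∃ a, (e i * a * e j) • u ≠ 0) :
    ¬ HArrow (IsBasicSTT e) X Y := by
  rintro ⟨-, -, -, hXY⟩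
  have hP := hX.span (he.idem j)
  obtain ⟨a, ha⟩ := h
  have ha' : (e i * a * e j) • (⟨e j • u, Submodule.mem_span_singleton_self _⟩ :
      Submodule.span A {e j • u}) ≠ 0 := fun h => ha (by
    rw [← he.idem j, ← mul_assoc, mul_smul]
    exact congrArg Subtype.val h)
  obtain ⟨C, hC, hCP, hPC⟩ := he.exists_isBasicSTT K hij hP ⟨a, ha'⟩
  have hPX := he.not_memFac_of_universal K hij hX hP.fix hP.gen
  have := hC.1.1
  have hjv : e j • v = v := by simpa using sum_smul hY.kill v
  obtain ⟨φ, hφ⟩ := hP.exists_hom (M := Y) (he.smul_eq_zero_of_support fun k hk =>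
    he.smul_eq_zero_of_notMem hY.kill (by simp_all)) hjv
  refine hXY C hC ⟨facLE_iff.2 (hCP.trans (memFac_of_surjective φ fun y => ?_)), fun h => ?_⟩
    ⟨facLE_iff.2 (hX.memFac (hPC.kill hP.kill)), fun h => hPX (hPC.trans (facLE_iff.1 h))⟩
  · obtain ⟨b, rfl⟩ := hY.gen y
    exact ⟨b • _, by rw [map_smul, hφ]⟩
  · refine ha' ?_
    rw [mul_smul, mul_smul]
    exact ((facLE_iff.1 h).trans hCP).kill
      (he.smul_eq_zero_of_notMem hY.kill (by simpa using hij)) _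

include K in
theorem hArrow_iff [DecidableEq ι] (he : IsBasicFamily e) (hij : i ≠ j)
    (hX : IsUniversal (1 - ∑ k ∈ {i, j}, e k) 1 X u)
    (hY : IsUniversal (1 - ∑ k ∈ {j}, e k) 1 Y v) :
    HArrow (IsBasicSTT e) X Y ↔ ∀ a, (e i * a * e j) • u = 0 :=
  ⟨fun h => by
    by_contra! h'
    exact he.not_hArrow_of_exists K hij hX hY h' h, he.hArrow_of_forall K hij hX hY⟩

end IsBasicFamily

end NotCover

section GabrielPresentation

variable {Λ : Type} [Ring Λ]

/-- The map `xΛ → yΛ` given by left multiplication by `u = ux`. -/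
def projModHom (x y u : Λ) (hu : u * x = u) : projMod Λ x →ₗ[Λᵐᵒᵖ] projMod Λ y :=
  (rSpan Λ {1 - x}).mapQ (rSpan Λ {1 - y}) (DistribSMul.toLinearMap Λᵐᵒᵖ Λ u) <|
    Submodule.span_le.2 <| Set.singleton_subset_iff.2 <| by simp [mul_sub, hu]

theorem projModHom_comp {x y u v : Λ} (hu : u * x = u) (hv : v * y = v) (h : v * u = x) :
    (projModHom y x v hv).comp (projModHom x y u hu) = LinearMap.id := by
  refine Submodule.linearMap_qext _ (LinearMap.ext fun s => ?_)
  refine (Submodule.Quotient.eq (rSpan Λ {1 - x})).2 ?_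
  have : v * (u * s) - s = op (-s) • (1 - x) := by
    rw [← mul_assoc, h, op_smul_eq_mul]
    noncomm_ring
  change v * (u * s) - s ∈ _
  rw [this]
  exact Submodule.smul_mem _ _ (Submodule.mem_span_singleton_self _)

theorem CompletePrimIdems.isBasicFamily {ι : Type} [Fintype ι] {e : ι → Λ}
    (he : CompletePrimIdems Λ e) (hb : IsBasicAlg Λ e) : IsBasicFamily e where
  prim := he.1
  orth h := he.2.1 h
  sum := he.2.2
  notEquiv {k l} hkl a b hab := by
    obtain ⟨hk, hk0, -⟩ := he.1 k
    obtain ⟨hl, -, hl'⟩ := he.1 l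
    have hk : e k * e k = e k := hk
    have hl : e l * e l = e l := hl
    set u := e l * b * e k
    set v := e k * a * e l
    have hlu : e l * u = u := by simp only [u, ← mul_assoc, hl]
    have hku : e k * v = v := by simp only [v, ← mul_assoc, hk]
    have hu : u * e k = u := by simp only [u, mul_assoc, hk]
    have hv : v * e l = v := by simp only [v, mul_assoc, hl]
    have hvu : v * u = e k := by
      rw [← hab]
      simp only [u, v, mul_assoc]
      rw [← mul_assoc (e l) (e l), hl]
    have huv : u * v * (u * v) = u * v := by
      rw [mul_assoc, ← mul_assoc v, hvu, hku]
    have hluv : e l * (u * v) = u * v := by rw [← mul_assoc, hlu]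
    have huvl : u * v * e l = u * v := by rw [mul_assoc, hv]
    have hel : u * v = e l := by
      rcases hl' (u * v) (e l - u * v) huv
        (by simp [IsIdempotentElem, mul_sub, sub_mul, hl, huv, hluv, huvl])
        (by simp [mul_sub, huv, huvl]) (by simp [sub_mul, huv, hluv]) (by abel) with h | h
      · refine absurd ?_ hk0
        rw [← hk, ← hvu, mul_assoc, ← mul_assoc u, h, zero_mul, mul_zero]
      · exact (sub_eq_zero.1 h).symm
    exact (hb k l hkl).elim (LinearEquiv.ofLinearMap (projModHom _ _ u hu) (projModHom _ _ v hv)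
      (projModHom_comp hv hu hel) (projModHom_comp hu hv hvu))

theorem mul_mem_tIdeal {q t : Λ} (a b : Λ) (ht : t ∈ tIdeal Λ q) : a * t * b ∈ tIdeal Λ q := by
  refine Submodule.smul_mem _ (op b) ?_
  induction ht using Submodule.span_induction with
  | mem y hy =>
    obtain ⟨c, rfl⟩ := hy
    exact Submodule.subset_span ⟨a * c, by rw [mul_assoc]⟩
  | zero => simp
  | add y z _ _ hy hz => simpa [mul_add] using add_mem hy hz
  | smul r y _ hy => simpa [mul_assoc] using Submodule.smul_mem _ r hy

theorem mem_tIdeal_self (q : Λ) : q ∈ tIdeal Λ q :=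
  Submodule.subset_span ⟨1, (one_mul q).symm⟩

theorem op_smul_mkQ_one (S : Submodule Λᵐᵒᵖ Λ) (x : Λ) : op x • S.mkQ 1 = S.mkQ x := by
  rw [← map_smul, op_smul_eq_mul, one_mul]

theorem isUniversal_quotMod (q : Λ) :
    IsUniversal (op q) 1 (quotMod Λ (tIdeal Λ q)) ((tIdeal Λ q).mkQ 1) where
  fix := one_smul _ _
  kill x := by
    obtain ⟨a, rfl⟩ := (tIdeal Λ q).mkQ_surjective x
    refine (Submodule.Quotient.mk_eq_zero _).2 (Submodule.subset_span ⟨a, rfl⟩)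
  gen x := by
    obtain ⟨a, rfl⟩ := (tIdeal Λ q).mkQ_surjective x
    exact ⟨op a, op_smul_mkQ_one _ a⟩
  lift a ha M hM m _ := by
    have ha' : a.unop ∈ tIdeal Λ q :=
      (Submodule.Quotient.mk_eq_zero _).1 ((op_smul_mkQ_one _ a.unop).symm.trans ha)
    suffices h : ∀ t ∈ tIdeal Λ q, op t • m = 0 from h _ ha'
    intro t ht
    induction ht using Submodule.span_induction with
    | mem y hy =>
      obtain ⟨c, rfl⟩ := hy
      rw [op_mul, mul_smul, hM]
    | zero => rw [op_zero, zero_smul]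
    | add y z _ _ hy hz => rw [op_add, add_smul, hy, hz, add_zero]
    | smul r y _ hy =>
      rw [← op_unop r, op_smul_eq_mul, op_mul, mul_smul, hy, smul_zero]

variable (K : Type) [Field K] [Algebra K Λ]

theorem mem_radK {x : Λ} : x ∈ radK K Λ ↔ x ∈ Ring.jacobson Λ := by
  rw [Ring.jacobson_eq_sInf_isMaximal]
  rfl

theorem exists_radK_pow_eq_bot [FiniteDimensional K Λ] : ∃ n, radK K Λ ^ (n + 1) = ⊥ := by
  have := IsArtinianRing.of_finite K Λ
  obtain ⟨n, hn⟩ := IsSemiprimaryRing.isNilpotent (R := Λ)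
  have h : ∀ m, radK K Λ ^ (m + 1) ≤ (Ring.jacobson Λ ^ (m + 1)).restrictScalars K := by
    intro m
    induction m with
    | zero => 
      intro x hx
      rw [zero_add, pow_one] at hx
      rw [zero_add, Submodule.pow_one]
      exact (mem_radK K).1 hx
    | succ m ih =>
      rw [pow_succ, Submodule.mul_le]
      intro x hx y hy
      rw [Submodule.restrictScalars_mem, Submodule.pow_succ]
      exact Ideal.mul_mem_mul (ih hx) ((mem_radK K).1 hy)
  refine ⟨n, le_bot_iff.1 ((h n).trans ?_)⟩
  have h0 := Ideal.pow_le_pow_right (I := Ring.jacobson Λ) n.le_succ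
  exact h0.trans hn.le

variable {K} {ι : Type} [Fintype ι] {e : ι → Λ}

namespace IsBasicFamily

theorem corner_mem_radK [FiniteDimensional K Λ] (he : IsBasicFamily e) {k l : ι} (hkl : k ≠ l)
    (a : Λ) : e k * a * e l ∈ radK K Λ :=
  (mem_radK K).2 (he.corner_mem_jacobson K hkl a)

theorem mem_tIdeal_of_notMem (he : IsBasicFamily e) {i j k : ι} (hki : k ≠ i) (hkj : k ≠ j) :
    e k ∈ tIdeal Λ (1 - e i - e j) := by
  have := mul_mem_tIdeal (e k) 1 (mem_tIdeal_self (1 - e i - e j))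
  simpa [mul_sub, he.orth hki, he.orth hkj] using this

variable [DecidableEq ι]

theorem compl_eq_sum (he : IsBasicFamily e) {i j : ι} (hij : i ≠ j) :
    1 - e i - e j = ∑ k ∈ ({i, j} : Finset ι)ᶜ, e k := by
  rw [sub_sub, ← Finset.sum_pair hij, ← he.sum, sub_eq_iff_eq_add, Finset.sum_compl_add_sum]

theorem corner_mem_of_mem_tIdeal [FiniteDimensional K Λ] (he : IsBasicFamily e) {i j : ι}
    (hij : i ≠ j) {t : Λ} (ht : t ∈ tIdeal Λ (1 - e i - e j)) :
    e j * t * e i ∈ radK K Λ * radK K Λ := by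
  suffices h : ∀ b, e j * (t * b) * e i ∈ radK K Λ * radK K Λ by simpa using h 1
  induction ht using Submodule.span_induction with
  | mem y hy =>
    obtain ⟨a, rfl⟩ := hy
    intro b
    rw [he.compl_eq_sum hij, Finset.mul_sum, Finset.sum_mul, Finset.mul_sum, Finset.sum_mul]
    refine Submodule.sum_mem _ fun k hk => ?_
    obtain ⟨hki, hkj⟩ : k ≠ i ∧ k ≠ j := by simpa using hk
    have : e j * (a * e k * b) * e i = e j * a * e k * (e k * b * e i) := by
      simp only [mul_assoc]
      rw [← mul_assoc (e k) (e k), he.idem]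
    rw [this]
    exact Submodule.mul_mem_mul (he.corner_mem_radK hkj.symm a) (he.corner_mem_radK hki b)
  | zero => simp
  | add y z _ _ hy hz =>
    intro b
    simpa [add_mul, mul_add] using add_mem (hy b) (hz b)
  | smul r y _ hy =>
    intro b
    simpa [mul_assoc] using hy (r.unop * b)

end IsBasicFamily

variable [DecidableEq ι] {Arr : ι → ι → Type} [∀ i j, Fintype (Arr i j)]
  {arr : ∀ i j, Arr i j → Λ}

namespace IsGabrielPres

theorem isBasicFamily (h : IsGabrielPres Λ K e Arr arr) : IsBasicFamily e :=
  h.1.isBasicFamily h.2.1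

theorem arr_notMem (h : IsGabrielPres Λ K e Arr arr) {i j : ι} (a : Arr i j) :
    arr i j a ∉ radK K Λ * radK K Λ := fun ha => by
  classical
  have := h.2.2.2.2 (Pi.single ⟨i, j, a⟩ 1)
    (by simpa [Pi.single_apply, ite_smul] using ha) ⟨i, j, a⟩
  simp at this

variable [FiniteDimensional K Λ]

theorem corner_le (h : IsGabrielPres Λ K e Arr arr) {i j : ι} (hij : i ≠ j)
    (hji : IsEmpty (Arr j i)) {T V : Submodule K Λ}
    (hT : ∀ t, t ∈ T ↔ t ∈ tIdeal Λ (1 - e i - e j))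
    (hV : ∀ v, v ∈ V ↔ e j * v * e i = v) :
    V ≤ T ⊔ radK K Λ * V ⊔ V * radK K Λ := by
  have he := h.isBasicFamily
  let f : Λ →ₗ[K] Λ := (LinearMap.mulRight K (e i)).comp (LinearMap.mulLeft K (e j))
  have hVrad : V ≤ radK K Λ := fun v hv => by
    rw [← (hV v).1 hv]
    exact he.corner_mem_radK hij.symm v
  have hff : V ≤ V.map f := fun v hv => ⟨v, hv, (hV v).1 hv⟩
  refine hff.trans ((Submodule.map_mono (hVrad.trans h.2.2.2.1)).trans ?_)
  rw [Submodule.map_sup, sup_le_iff, Submodule.map_span_le, Submodule.map_le_iff_le_comap,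
    Submodule.mul_le]
  constructor
  · rintro _ ⟨⟨k, l, a⟩, rfl⟩
    have harr := (h.2.2.1 k l a).2
    suffices hz : f (arr k l a) = 0 from hz ▸ zero_mem _
    change e j * arr k l a * e i = 0
    rw [← harr]
    by_cases hk : j = k
    · by_cases hl : l = i
      · subst hk hl
        exact hji.elim a
      · simp only [mul_assoc, he.orth hl, mul_zero]
    · simp only [← mul_assoc, he.orth hk, zero_mul]
  · intro x hx y hy
    have key : f (x * y) = ∑ k, e j * x * e k * (e k * y * e i) := by
      change e j * (x * y) * e i = _
      calc e j * (x * y) * e i = e j * x * 1 * y * e i := by simp only [mul_assoc, one_mul]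
        _ = _ := by
          rw [← he.sum, Finset.mul_sum, Finset.sum_mul, Finset.sum_mul]
          refine Finset.sum_congr rfl fun k _ => ?_
          simp only [mul_assoc]
          rw [← mul_assoc (e k) (e k), he.idem]
    rw [Submodule.mem_comap, key]
    have hrad : ∀ {z} (a b : Λ), z ∈ radK K Λ → a * z * b ∈ radK K Λ := fun a b hz => by
      rw [mem_radK] at hz ⊢
      exact Ideal.mul_mem_right _ _ (Ideal.mul_mem_left _ _ hz)
    refine sum_mem fun k _ => ?_
    by_cases hkj : k = j
    · subst hkj
      refine Submodule.mem_sup_left (Submodule.mem_sup_right (Submodule.mul_mem_mul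
        (hrad _ _ hx) ((hV _).2 ?_)))
      simp only [mul_assoc, he.idem]
      simp only [← mul_assoc, he.idem]
    by_cases hki : k = i
    · subst hki
      refine Submodule.mem_sup_right (Submodule.mul_mem_mul ((hV _).2 ?_) (hrad _ _ hy))
      simp only [mul_assoc, he.idem]
      simp only [← mul_assoc, he.idem]
    · refine Submodule.mem_sup_left (Submodule.mem_sup_left ((hT _).2 ?_))
      exact mul_mem_tIdeal _ _ (he.mem_tIdeal_of_notMem hki hkj)

/-- `e_j Λ e_i` is contained in the ideal generated by the other idempotents exactly when there
is no arrow from `j` to `i`. -/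
theorem forall_mem_tIdeal_iff (h : IsGabrielPres Λ K e Arr arr) {i j : ι} (hij : i ≠ j) :
    (∀ x, e j * x * e i ∈ tIdeal Λ (1 - e i - e j)) ↔ IsEmpty (Arr j i) := by
  have he := h.isBasicFamily
  refine ⟨fun hx => ⟨fun a => h.arr_notMem a ?_⟩, fun hji x => ?_⟩
  · obtain ⟨-, ha⟩ := h.2.2.1 j i a
    have := he.corner_mem_of_mem_tIdeal (K := K) hij (hx (arr j i a))
    rwa [ha, ha] at this
  let T : Submodule K Λ := (tIdeal Λ (1 - e i - e j)).restrictScalars K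
  let V : Submodule K Λ := LinearMap.range
    ((LinearMap.mulRight K (e i)).comp (LinearMap.mulLeft K (e j)))
  have hV : ∀ v, v ∈ V ↔ e j * v * e i = v := fun v => by
    refine ⟨?_, fun hv => ⟨v, hv⟩⟩
    rintro ⟨y, rfl⟩
    change e j * (e j * y * e i) * e i = e j * y * e i
    simp only [mul_assoc, he.idem]
    simp only [← mul_assoc, he.idem]
  have hle := h.corner_le hij hji (T := T) (fun _ => Iff.rfl) hV
  have hpow : ∀ n, V ≤ T ⊔ radK K Λ ^ (n + 1) := by
    intro n
    induction n with
    | zero =>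
      rw [zero_add, pow_one]
      refine le_sup_of_le_right fun v hv => ?_
      rw [← (hV v).1 hv]
      exact he.corner_mem_radK hij.symm v
    | succ n ih =>
      refine hle.trans (sup_le (sup_le le_sup_left ?_) ?_)
      · refine (mul_le_mul_right ih _).trans ?_
        rw [Submodule.mul_sup, ← pow_succ']
        refine sup_le_sup_right (Submodule.mul_le.2 fun r _ t ht => ?_) _
        simpa [T] using mul_mem_tIdeal r 1 ht
      · refine (mul_le_mul_left ih _).trans ?_
        rw [Submodule.sup_mul, ← pow_succ]
        refine sup_le_sup_right (Submodule.mul_le.2 fun t ht r _ => ?_) _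
        simpa [T] using mul_mem_tIdeal 1 r ht
  obtain ⟨n, hn⟩ := exists_radK_pow_eq_bot K (Λ := Λ)
  have := hpow n
  rw [hn, sup_bot_eq] at this
  exact this ⟨x, rfl⟩

theorem hArrow_iff (h : IsGabrielPres Λ K e Arr arr) {i j : ι} (hij : i ≠ j) :
    HArrow (IsBSTT Λ e) (quotMod Λ (tIdeal Λ (1 - e i - e j))) (cyclicQuot Λ (e j)) ↔
      IsEmpty (Arr j i) := by
  have hX := isUniversal_quotMod (1 - e i - e j)
  have hY := isUniversal_quotMod (1 - e j)
  have hX' : op (1 - e i - e j) = 1 - ∑ k ∈ {i, j}, op (e k) := by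
    rw [Finset.sum_pair hij, sub_sub, op_sub, op_one, op_add]
  have hY' : op (1 - e j) = 1 - ∑ k ∈ {j}, op (e k) := by
    rw [Finset.sum_singleton, op_sub, op_one]
  rw [hX'] at hX
  rw [hY'] at hY
  refine (h.isBasicFamily.op.hArrow_iff K hij hX hY).trans (Iff.trans ?_
    (h.forall_mem_tIdeal_iff hij))
  refine op_surjective.forall.trans (forall_congr' fun x => ?_)
  rw [← op_mul, ← op_mul, ← mul_assoc]
  exact (op_smul_mkQ_one _ _).congr_left.trans (Submodule.Quotient.mk_eq_zero _)

theorem isBSTT (h : IsGabrielPres Λ K e Arr arr) {i j : ι} (hij : i ≠ j) :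
    IsBSTT Λ e (quotMod Λ (tIdeal Λ (1 - e i - e j))) := by
  have hX := isUniversal_quotMod (1 - e i - e j)
  have hX' : op (1 - e i - e j) = 1 - ∑ k ∈ {i, j}, op (e k) := by
    rw [Finset.sum_pair hij, sub_sub, op_sub, op_one, op_add]
  rw [hX'] at hX
  exact h.isBasicFamily.op.isBasicSTT K hX

end IsGabrielPres

end GabrielPresentation

end TauTilting

open TauTilting in
/-- For `i ≠ j ∈ Q₀` let `Λ' = Λ/(1-e_i-e_j)`, regarded as a
right `Λ`-module (it is a basic support τ-tilting module).  Then the existence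
of arrows between `i` and `j` in `Q` is detected by whether `Λ'` is a direct
predecessor of `X_i` resp. `X_j` in the Hasse quiver of `sτtilt Λ`. -/
theorem statement5
    (K : Type) [Field K]
    (Λ : Type) [Ring Λ] [Algebra K Λ] [FiniteDimensional K Λ]
    (ι : Type) [Fintype ι] [DecidableEq ι] (e : ι → Λ)
    (Arr : ι → ι → Type) [∀ i j, Fintype (Arr i j)] (arr : ∀ i j, Arr i j → Λ)
    (hpres : IsGabrielPres Λ K e Arr arr)
    (i j : ι) (hij : i ≠ j)
    (Λ' : Mdl Λᵐᵒᵖ) (hΛ' : Λ' = quotMod Λ (tIdeal Λ (1 - e i - e j))) :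
    IsBSTT Λ e Λ' ∧
    -- (1)
    ((IsEmpty (Arr i j) ∧ IsEmpty (Arr j i)) ↔
      (HArrow (IsBSTT Λ e) Λ' (cyclicQuot Λ (e i)) ∧
       HArrow (IsBSTT Λ e) Λ' (cyclicQuot Λ (e j)))) ∧
    -- (2)
    ((Nonempty (Arr i j) ∧ IsEmpty (Arr j i)) ↔
      (HArrow (IsBSTT Λ e) Λ' (cyclicQuot Λ (e j)) ∧
       ¬ HArrow (IsBSTT Λ e) Λ' (cyclicQuot Λ (e i)))) ∧
    -- (3)
    ((Nonempty (Arr i j) ∧ Nonempty (Arr j i)) ↔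
      (¬ HArrow (IsBSTT Λ e) Λ' (cyclicQuot Λ (e i)) ∧
       ¬ HArrow (IsBSTT Λ e) Λ' (cyclicQuot Λ (e j)))) := by
  subst hΛ'
  have hj := hpres.hArrow_iff hij
  have hi := hpres.hArrow_iff hij.symm
  rw [sub_right_comm] at hi
  refine ⟨hpres.isBSTT hij, ?_⟩
  rw [hi, hj]
  simp only [not_isEmpty_iff]
  tauto
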